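/- Let H be a fixed strictly 2-balanced graph other than the two-edge path and the triangle. There are constants C, c, ς, ϵ₀ > 0 such that for every sequence p = p(n) ∈ (0,1]: (i) if Λ^{p(n)} > C·log n and p(n) < n^c·p*_H(n) for all large n, then w.h.p. σ_{G_{n,p}}(x,y) ≥ ϵ₀·Λ^{p(n)} for every pair of distinct vertices x, y ∈ [n]; and (ii) if p(n) ≥ n^c·p*_H(n) for all large n, then w.h.p. σ_{G_{n,p}}(x,y) ≥ ϵ₀·n^ς·p(n)/p*_H(n) for every pair of distinct vertices x, y ∈ [n]. -/

import Mathlib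

open Finset SimpleGraph Filter Topology

noncomputable section
open scoped Classical

namespace RG

variable {α β V : Type*}

/-- The number of edges of a graph. -/
def eCount (H : SimpleGraph α) : ℕ := Nat.card ↥H.edgeSet

/-- The number of automorphisms of a graph. -/
def autCount (H : SimpleGraph α) : ℕ := Nat.card (H ≃g H)

/-- Every vertex has even degree. -/
def IsEulerianGraph (H : SimpleGraph α) : Prop :=
  ∀ v, Even (Nat.card ↥(H.neighborSet v))

/-- Vectors in the ambient 𝔽₂ edge space on the vertex type `V`. -/
abbrev EdgeVec (V : Type*) := Sym2 V → ZMod 2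

/-- Indicator vector of a set of edges. -/
def setVec (s : Set (Sym2 V)) : EdgeVec V := fun e => if e ∈ s then 1 else 0

/-- The support (set of edges) of an edge-space vector. -/
def suppSet (f : EdgeVec V) : Set (Sym2 V) := {e | f e ≠ 0}

/-- The number of edges of an edge-space vector. -/
def wt (f : EdgeVec V) : ℕ := Nat.card ↥(suppSet f)

/-- The edge space `E(G)`: the span of the indicators of single edges of `G`,
i.e. all vectors supported on `E(G)`. -/
def edgeSpace (G : SimpleGraph V) : Submodule (ZMod 2) (EdgeVec V) :=
  Submodule.span (ZMod 2) {f | ∃ e ∈ G.edgeSet, f = setVec {e}}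

/-- The mod-2 degree of the vertex `v` in an edge-space vector. -/
def parityMap [Fintype V] [DecidableEq V] (v : V) : EdgeVec V →ₗ[ZMod 2] ZMod 2 where
  toFun f := ∑ w ∈ Finset.univ.erase v, f s(v, w)
  map_add' f g := by simp [Finset.sum_add_distrib]
  map_smul' c f := by simp [Finset.mul_sum, mul_sub]

/-- The cycle space `C(G)`: members of `E(G)` in which every vertex has even degree. -/
def cycleSpace [Fintype V] [DecidableEq V] (G : SimpleGraph V) :
    Submodule (ZMod 2) (EdgeVec V) :=
  edgeSpace G ⊓ ⨅ v : V, LinearMap.ker (parityMap v)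

/-- The mod-2 total number of edges of an edge-space vector. -/
def totalMap [Fintype V] [DecidableEq V] : EdgeVec V →ₗ[ZMod 2] ZMod 2 where
  toFun f := ∑ e, f e
  map_add' f g := by simp [Finset.sum_add_distrib]
  map_smul' c f := by simp [Finset.mul_sum, mul_sub]

/-- The space `D(G)` of even-size members of `E(G)`. -/
def dSpace [Fintype V] [DecidableEq V] (G : SimpleGraph V) :
    Submodule (ZMod 2) (EdgeVec V) :=
  edgeSpace G ⊓ LinearMap.ker (totalMap (V := V))

/-- The `H`-space `C_H(G)`: the span of the (indicators of the edge sets of) copies of `H`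
in `G`. -/
def hSpace (H : SimpleGraph α) (G : SimpleGraph V) : Submodule (ZMod 2) (EdgeVec V) :=
  Submodule.span (ZMod 2)
    {f | ∃ K : G.Subgraph, Nonempty (H ≃g K.coe) ∧ f = setVec K.edgeSet}

/-- `W_H(G)`, the natural candidate value of `C_H(G)`. -/
def wSpace [Fintype V] [DecidableEq V] (H : SimpleGraph α) (G : SimpleGraph V) :
    Submodule (ZMod 2) (EdgeVec V) :=
  if IsEulerianGraph H then
    if Odd (eCount H) then cycleSpace G else cycleSpace G ⊓ dSpace G
  else
    if Odd (eCount H) then edgeSpace G else dSpace G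

/-- `G ∈ T_H` : the `H`-space equals its natural value. -/
def memT [Fintype V] [DecidableEq V] (H : SimpleGraph α) (G : SimpleGraph V) : Prop :=
  hSpace H G = wSpace H G

/-- `G ∈ Q_H` : every edge of `G` lies in a copy of `H`. -/
def memQ (H : SimpleGraph α) (G : SimpleGraph V) : Prop :=
  ∀ e ∈ G.edgeSet, ∃ K : G.Subgraph, Nonempty (H ≃g K.coe) ∧ e ∈ K.edgeSet

/-- The standard 𝔽₂ inner product `⟨f,g⟩ = |f ∩ g| mod 2`. -/
def ip [Fintype V] [DecidableEq V] (f g : EdgeVec V) : ZMod 2 := ∑ e, f e * g e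

/-- The orthogonal complement of `S` inside the edge space of `G`. -/
def perpIn [Fintype V] [DecidableEq V] (G : SimpleGraph V)
    (S : Submodule (ZMod 2) (EdgeVec V)) : Set (EdgeVec V) :=
  {f | f ∈ edgeSpace G ∧ ∀ g ∈ S, ip f g = 0}

/-- The probability that the Erdős–Rényi random graph `G_{n,p}` lies in the set `A`. -/
def erProb (n : ℕ) (p : ℝ) (A : Set (SimpleGraph (Fin n))) : ℝ :=
  ∑ s ∈ (⊤ : SimpleGraph (Fin n)).edgeFinset.powerset,
    if SimpleGraph.fromEdgeSet (↑s) ∈ A then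
      p ^ s.card * (1 - p) ^ ((⊤ : SimpleGraph (Fin n)).edgeFinset.card - s.card)
    else 0

/-- `(e-1)/(v-2)` when `v ≥ 3`, and `0` otherwise. -/
def density2 (v e : ℕ) : ℝ := if 3 ≤ v then ((e : ℝ) - 1) / ((v : ℝ) - 2) else 0

/-- The 2-density `d₂(H)`. -/
def d2 (H : SimpleGraph α) : ℝ := density2 (Nat.card α) (eCount H)

/-- The 2-density of a subgraph. -/
def subDensity2 {H : SimpleGraph α} (K : H.Subgraph) : ℝ :=
  density2 (Nat.card ↥K.verts) (Nat.card ↥K.edgeSet)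

/-- The maximum 2-density `m₂(H)`. -/
def m2 (H : SimpleGraph α) : ℝ := sSup {x : ℝ | ∃ K : H.Subgraph, x = subDensity2 K}

/-- `H` is strictly 2-balanced. -/
def Strictly2Balanced (H : SimpleGraph α) : Prop :=
  3 ≤ Nat.card α ∧ ∀ K : H.Subgraph, K ≠ ⊤ → subDensity2 K < d2 H

/-- `ϱ(H) = Σ_{(a,b)} 1/aut(H;a,b) = 2·e_H/aut(H)`. -/
def rho (H : SimpleGraph α) : ℝ := 2 * (eCount H : ℝ) / (autCount H : ℝ)

/-- The sharp threshold `p*_H(n)` for `Q_H`. -/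
def pStar (H : SimpleGraph α) (n : ℕ) : ℝ :=
  (n : ℝ) ^ (-(1 / m2 H)) *
    ((2 - 1 / m2 H) * (rho H)⁻¹ * Real.log n) ^ (1 / ((eCount H : ℝ) - 1))

/-- `Λ^p = ϱ(H)·(n-2)_{v_H-2}·p^{e_H-1}`, the expected number of copies of `H` on a
fixed edge. -/
def Lambda (H : SimpleGraph α) (n : ℕ) (p : ℝ) : ℝ :=
  rho H * ((n - 2).descFactorial (Nat.card α - 2) : ℝ) * p ^ (eCount H - 1)

/-- `H` is isomorphic neither to the two-edge path nor to the triangle. -/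
def NotPathOrTriangle (H : SimpleGraph α) : Prop :=
  ¬ Nonempty (H ≃g SimpleGraph.pathGraph 3) ∧ ¬ Nonempty (H ≃g (⊤ : SimpleGraph (Fin 3)))

/-! ### Bridges -/

/-- `G` together with the edge `xy`. -/
def bridgeHost (G : SimpleGraph V) (x y : V) : SimpleGraph V :=
  G ⊔ SimpleGraph.fromEdgeSet {s(x, y)}

/-- A copy of `H` in `G ∪ {xy}` containing the edge `xy`; such copies correspond to the
`xy`-bridges `K - xy` of `G`. -/
def IsBridgeCopy (H : SimpleGraph α) (G : SimpleGraph V) (x y : V)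
    (K : (bridgeHost G x y).Subgraph) : Prop :=
  Nonempty (H ≃g K.coe) ∧ s(x, y) ∈ K.edgeSet

/-- `τ_G(x,y)`: the number of `xy`-bridges in `G`. -/
def tauB (H : SimpleGraph α) (G : SimpleGraph V) (x y : V) : ℕ :=
  Nat.card {K : (bridgeHost G x y).Subgraph // IsBridgeCopy H G x y K}

/-- `σ_G(x,y)`: the maximum size of a family of internally disjoint `xy`-bridges in `G`. -/
def sigmaB (H : SimpleGraph α) (G : SimpleGraph V) (x y : V) : ℕ :=
  sSup {m | ∃ T : Finset ((bridgeHost G x y).Subgraph),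
    (∀ K ∈ T, IsBridgeCopy H G x y K) ∧
    (∀ K ∈ T, ∀ K' ∈ T, K ≠ K' → (K.verts ∩ K'.verts : Set V) ⊆ {x, y}) ∧ T.card = m}

/-- An `S`-central `xy`-bridge: the bridge contains an odd number of edges of `S`, at
least one of which misses `{x,y}`. -/
def IsCentralBridge (H : SimpleGraph α) (G : SimpleGraph V) (S : Set (Sym2 V)) (x y : V)
    (K : (bridgeHost G x y).Subgraph) : Prop :=
  IsBridgeCopy H G x y K ∧
  Odd (Nat.card {e : Sym2 V // e ∈ K.edgeSet ∧ e ≠ s(x, y) ∧ e ∈ S}) ∧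
  ∃ e ∈ K.edgeSet, e ∈ S ∧ x ∉ e ∧ y ∉ e

/-- `σ_G(xy; S)`: the maximum size of a family of internally disjoint `S`-central
`xy`-bridges in `G`. -/
def sigmaCentral (H : SimpleGraph α) (G : SimpleGraph V) (S : Set (Sym2 V)) (x y : V) : ℕ :=
  sSup {m | ∃ T : Finset ((bridgeHost G x y).Subgraph),
    (∀ K ∈ T, IsCentralBridge H G S x y K) ∧
    (∀ K ∈ T, ∀ K' ∈ T, K ≠ K' → (K.verts ∩ K'.verts : Set V) ⊆ {x, y}) ∧ T.card = m}

/-! ### Extensions `[W,Z]` -/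

/-- The adjacency relation of the pair `[W,Z]` in `F`: edges of `F[Z]` which do not lie
inside `W`. -/
def PairAdj (F : SimpleGraph β) (W Z : Set β) (a b : ↥Z) : Prop :=
  F.Adj (a : β) (b : β) ∧ ¬((a : β) ∈ W ∧ (b : β) ∈ W)

/-- `v(W,Z)`: the number of internal vertices of `[W,Z]`. -/
def vWZ (W Z : Set β) : ℕ := Nat.card ↥(Z \ W)

/-- `e(W,Z)`: the number of edges of `[W,Z]`. -/
def eWZ (F : SimpleGraph β) (W Z : Set β) : ℕ :=
  Nat.card {q : Sym2 β // q ∈ F.edgeSet ∧ (∀ a ∈ q, a ∈ Z) ∧ ¬(∀ a ∈ q, a ∈ W)}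

/-- `d(W,Z) = e(W,Z)/v(W,Z)`. -/
def dWZ (F : SimpleGraph β) (W Z : Set β) : ℝ := (eWZ F W Z : ℝ) / (vWZ W Z : ℝ)

/-- `[W,Z]` is strictly balanced. -/
def StrictlyBalancedWZ (F : SimpleGraph β) (W Z : Set β) : Prop :=
  ∀ Y : Set β, W ⊂ Y → Y ⊂ Z → dWZ F W Y < dWZ F W Z

/-- `m(W,Z) = max{d(W,Y) : W ⊊ Y ⊆ Z}`. -/
def mWZ (F : SimpleGraph β) (W Z : Set β) : ℝ :=
  sSup {x : ℝ | ∃ Y : Set β, W ⊂ Y ∧ Y ⊆ Z ∧ x = dWZ F W Y}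

/-- `aut[W,Z]`: the number of automorphisms of `[W,Z]` fixing `W` pointwise. -/
def autWZ (F : SimpleGraph β) (W Z : Set β) : ℕ :=
  Nat.card {γ : ↥Z ≃ ↥Z // (∀ w : ↥Z, (w : β) ∈ W → γ w = w) ∧
    ∀ a b : ↥Z, PairAdj F W Z a b ↔ PairAdj F W Z (γ a) (γ b)}

/-- `μ_p(W,Z) = n^{v(W,Z)}·p^{e(W,Z)}/aut[W,Z]`. -/
def muWZ (F : SimpleGraph β) (W Z : Set β) (n : ℕ) (p : ℝ) : ℝ :=
  (n : ℝ) ^ (vWZ W Z) * p ^ (eWZ F W Z) / (autWZ F W Z : ℝ)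

/-- A `[W,Z]`-extension on the tuple `x` in `G`. -/
def IsExt (F : SimpleGraph β) (W Z : Set β) (G : SimpleGraph V) (x : ↥W → V)
    (ψ : ↥Z → V) : Prop :=
  Function.Injective ψ ∧
  (∀ (w : ↥Z) (hw : (w : β) ∈ W), ψ w = x ⟨(w : β), hw⟩) ∧
  ∀ a b : ↥Z, PairAdj F W Z a b → G.Adj (ψ a) (ψ b)

/-- The data (internal vertex image, edge image) of an extension; two extensions are
equivalent (give the same copy) iff they have the same data. -/
def extData (F : SimpleGraph β) (W Z : Set β) (ψ : ↥Z → V) : Set V × Set (Sym2 V) :=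
  (ψ '' {z : ↥Z | (z : β) ∉ W},
   {q | ∃ a b : ↥Z, PairAdj F W Z a b ∧ q = s(ψ a, ψ b)})

/-- The set of copies of `[W,Z]` on `x` in `G`. -/
def copySet (F : SimpleGraph β) (W Z : Set β) (G : SimpleGraph V) (x : ↥W → V) :
    Set (Set V × Set (Sym2 V)) :=
  {d | ∃ ψ : ↥Z → V, IsExt F W Z G x ψ ∧ extData F W Z ψ = d}

/-- `τ_{[W,Z]}(G,X)`: the number of copies of `[W,Z]` on `x` in `G`. -/
def tauExt (F : SimpleGraph β) (W Z : Set β) (G : SimpleGraph V) (x : ↥W → V) : ℕ :=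
  Nat.card ↥(copySet F W Z G x)

/-- `σ_{[W,Z]}(G,X)`: the maximum size of a family of internally disjoint copies of
`[W,Z]` on `x` in `G`. -/
def sigmaExt (F : SimpleGraph β) (W Z : Set β) (G : SimpleGraph V) (x : ↥W → V) : ℕ :=
  sSup {m | ∃ T : Finset (Set V × Set (Sym2 V)),
    (↑T : Set (Set V × Set (Sym2 V))) ⊆ copySet F W Z G x ∧
    (∀ d ∈ T, ∀ d' ∈ T, d ≠ d' → d.1 ∩ d'.1 = ∅) ∧ T.card = m}

/-- `φ(x) = (1+x)log(1+x) - x` for `x > -1`, with `φ(-1) = 1`. -/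
def phiFn (x : ℝ) : ℝ := if x = -1 then 1 else (1 + x) * Real.log (1 + x) - x


/-! ### Bernoulli random subsets -/

section Bernoulli

variable {E : Type*} [DecidableEq E]

/-- The weight of the subset `s` of the ground set `U`. -/
def bw (U : Finset E) (p : ℝ) (s : Finset E) : ℝ := p ^ s.card * (1 - p) ^ (U.card - s.card)

/-- The probability that the `p`-random subset of `U` satisfies `P`. -/
def pr (U : Finset E) (p : ℝ) (P : Finset E → Prop) : ℝ :=
  ∑ s ∈ U.powerset, if P s then bw U p s else 0

lemma bw_nonneg (U : Finset E) {p : ℝ} (h0 : 0 ≤ p) (h1 : p ≤ 1) (s : Finset E) :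
    0 ≤ bw U p s :=
  mul_nonneg (pow_nonneg h0 _) (pow_nonneg (by linarith) _)

lemma sum_bw (U : Finset E) (p : ℝ) : ∑ s ∈ U.powerset, bw U p s = 1 := by
  unfold bw
  rw [Finset.sum_pow_mul_eq_add_pow]; simp

lemma pr_true (U : Finset E) (p : ℝ) : pr U p (fun _ => True) = 1 := by
  simp [pr, sum_bw]

lemma pr_nonneg (U : Finset E) {p : ℝ} (h0 : 0 ≤ p) (h1 : p ≤ 1) (P : Finset E → Prop) :
    0 ≤ pr U p P := by
  refine Finset.sum_nonneg fun s _ => ?_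
  split_ifs
  · exact bw_nonneg U h0 h1 s
  · exact le_rfl

lemma pr_mono (U : Finset E) {p : ℝ} (h0 : 0 ≤ p) (h1 : p ≤ 1) {P Q : Finset E → Prop}
    (h : ∀ s ∈ U.powerset, P s → Q s) : pr U p P ≤ pr U p Q := by
  refine Finset.sum_le_sum fun s hs => ?_
  have := bw_nonneg U h0 h1 s
  by_cases hP : P s
  · simp [hP, h s hs hP]
  · simp only [hP, if_false]; split_ifs <;> simp [this]

lemma pr_congr (U : Finset E) (p : ℝ) {P Q : Finset E → Prop}
    (h : ∀ s ∈ U.powerset, P s ↔ Q s) : pr U p P = pr U p Q := by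
  refine Finset.sum_congr rfl fun s hs => ?_
  simp [h s hs]

lemma pr_and_add (U : Finset E) (p : ℝ) (P Q : Finset E → Prop) :
    pr U p (fun s => P s ∧ Q s) + pr U p (fun s => P s ∧ ¬ Q s) = pr U p P := by
  unfold pr
  rw [← Finset.sum_add_distrib]
  refine Finset.sum_congr rfl fun s hs => ?_
  by_cases hP : P s <;> by_cases hQ : Q s <;> simp [hP, hQ]

lemma pr_not (U : Finset E) (p : ℝ) (P : Finset E → Prop) :
    pr U p (fun s => ¬ P s) = 1 - pr U p P := by
  have := pr_and_add U p (fun _ => True) P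
  simp only [true_and] at this
  rw [pr_true] at this
  linarith

lemma pr_exists_le {ι : Type*} [DecidableEq ι] (U : Finset E) {p : ℝ} (h0 : 0 ≤ p) (h1 : p ≤ 1) (S : Finset ι)
    (P : ι → Finset E → Prop) :
    pr U p (fun s => ∃ i ∈ S, P i s) ≤ ∑ i ∈ S, pr U p (P i) := by
  unfold pr
  rw [Finset.sum_comm]
  refine Finset.sum_le_sum fun s hs => ?_
  have hb := bw_nonneg U h0 h1 s
  have hnn : ∀ i ∈ S, (0 : ℝ) ≤ if P i s then bw U p s else 0 := by
    intro i _; split_ifs <;> simp [hb]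
  split_ifs with h
  · obtain ⟨i, hi, hP⟩ := h
    refine le_trans ?_ (Finset.single_le_sum hnn hi)
    simp [hP]
  · exact Finset.sum_nonneg hnn

/-- A single coordinate is independent of an event not depending on it. -/
lemma pr_mem_and (U : Finset E) (p : ℝ) (e : E) (he : e ∈ U) (Q : Finset E → Prop)
    (hQ : ∀ s, Q (insert e s) ↔ Q s) :
    pr U p (fun s => e ∈ s ∧ Q s) = p * pr U p Q := by
  obtain ⟨U', heU', rfl⟩ : ∃ U', e ∉ U' ∧ U = insert e U' :=
    ⟨U.erase e, by simp, by simp [Finset.insert_erase he]⟩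
  unfold pr
  rw [Finset.sum_powerset_insert heU', Finset.sum_powerset_insert heU', mul_add,
    Finset.mul_sum, Finset.mul_sum, ← Finset.sum_add_distrib, ← Finset.sum_add_distrib]
  refine Finset.sum_congr rfl fun t ht => ?_
  have htU : t ⊆ U' := Finset.mem_powerset.mp ht
  have het : e ∉ t := fun h => heU' (htU h)
  have hc : t.card ≤ U'.card := Finset.card_le_card htU
  simp only [het, false_and, if_false, Finset.mem_insert_self, true_and, hQ]
  by_cases hq : Q t
  · simp only [hq, if_true, bw, Finset.card_insert_of_notMem het,
      Finset.card_insert_of_notMem heU']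
    have h1 : U'.card + 1 - (t.card + 1) = U'.card - t.card := by omega
    have h2 : U'.card + 1 - t.card = (U'.card - t.card) + 1 := by omega
    rw [h1, h2]; ring
  · simp [hq]

lemma pr_subset_and (U : Finset E) (p : ℝ) (D : Finset E) (hD : D ⊆ U) (Q : Finset E → Prop)
    (hQ : ∀ e ∈ D, ∀ s, Q (insert e s) ↔ Q s) :
    pr U p (fun s => D ⊆ s ∧ Q s) = p ^ D.card * pr U p Q := by
  induction D using Finset.induction_on with
  | empty => simp
  | insert e D he ih =>
    have h1 : pr U p (fun s => insert e D ⊆ s ∧ Q s)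
        = pr U p (fun s => e ∈ s ∧ (D ⊆ s ∧ Q s)) := by
      refine pr_congr U p fun s _ => ?_
      rw [Finset.insert_subset_iff, and_assoc]
    rw [h1, pr_mem_and U p e (hD (Finset.mem_insert_self _ _)), ih, Finset.card_insert_of_notMem he]
    · ring
    · exact fun x hx => hD (Finset.mem_insert_of_mem hx)
    · exact fun x hx => hQ x (Finset.mem_insert_of_mem hx)
    · intro s
      rw [hQ e (Finset.mem_insert_self _ _)]
      have : D ⊆ insert e s ↔ D ⊆ s := by
        constructor
        · intro h x hx
          have := h hx
          rw [Finset.mem_insert] at this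
          rcases this with rfl | h
          · exact absurd hx he
          · exact h
        · intro h x hx; exact Finset.mem_insert_of_mem (h hx)
      rw [this]

lemma pr_subset (U : Finset E) (p : ℝ) (D : Finset E) (hD : D ⊆ U) :
    pr U p (fun s => D ⊆ s) = p ^ D.card := by
  have := pr_subset_and U p D hD (fun _ => True) (by simp)
  simpa [pr_true] using this

/-- Harris' inequality for two increasing events. -/
lemma harris [Fintype E] (U : Finset E) {p : ℝ} (h0 : 0 ≤ p) (h1 : p ≤ 1)
    {A B : Finset E → Prop}
    (hA : ∀ s t, s ⊆ t → A s → A t) (hB : ∀ s t, s ⊆ t → B s → B t) :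
    pr U p A * pr U p B ≤ pr U p (fun s => A s ∧ B s) := by
  set μ : Finset E → ℝ := fun s => if s ⊆ U then bw U p s else 0 with hμ
  have key : ∀ P : Finset E → Prop,
      pr U p P = ∑ s, μ s * (if P s then (1 : ℝ) else 0) := by
    intro P
    unfold pr
    rw [← Finset.sum_filter_add_sum_filter_not Finset.univ (fun s => s ⊆ U)]
    have h2 : ∑ s ∈ Finset.univ.filter (fun s : Finset E => ¬ s ⊆ U),
        μ s * (if P s then (1 : ℝ) else 0) = 0 := by
      refine Finset.sum_eq_zero fun s hs => ?_
      have := (Finset.mem_filter.mp hs).2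
      simp [hμ, this]
    rw [h2, add_zero]
    have h3 : Finset.univ.filter (fun s : Finset E => s ⊆ U) = U.powerset := by
      ext s; simp
    rw [h3]
    refine Finset.sum_congr rfl fun s hs => ?_
    have := Finset.mem_powerset.mp hs
    simp [hμ, this]
  have hmono : ∀ P : Finset E → Prop, (∀ s t, s ⊆ t → P s → P t) →
      Monotone (fun s => if P s then (1 : ℝ) else 0) := by
    intro P hP s t hst
    by_cases h : P s
    · simp [h, hP s t hst h]
    · simp only [h, if_false]; split_ifs <;> norm_num
  have hnn : ∀ P : Finset E → Prop, (0 : Finset E → ℝ) ≤ (fun s => if P s then (1 : ℝ) else 0) := by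
    intro P s
    simp only [Pi.zero_apply]; split_ifs <;> norm_num
  have hμ0 : 0 ≤ μ := by
    intro s
    simp only [hμ, Pi.zero_apply]; split_ifs
    · exact bw_nonneg U h0 h1 s
    · exact le_rfl
  have hlog : ∀ a b, μ a * μ b ≤ μ (a ⊓ b) * μ (a ⊔ b) := by
    intro a b
    by_cases ha : a ⊆ U
    · by_cases hb : b ⊆ U
      · have hi : a ⊓ b ⊆ U := fun x hx => ha (Finset.mem_inter.mp hx).1
        have hu : a ⊔ b ⊆ U := Finset.union_subset ha hb
        simp only [hμ, ha, hb, hi, hu, if_true, bw]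
        have e1 : (a ⊓ b).card + (a ⊔ b).card = a.card + b.card :=
          Finset.card_inter_add_card_union a b
        have c1 := Finset.card_le_card ha
        have c2 := Finset.card_le_card hb
        have c3 := Finset.card_le_card hi
        have c4 := Finset.card_le_card hu
        apply le_of_eq
        calc _ = p ^ (a.card + b.card) * (1 - p) ^ ((U.card - a.card) + (U.card - b.card)) := by
              rw [pow_add, pow_add]; ring
          _ = p ^ ((a ⊓ b).card + (a ⊔ b).card) *
              (1 - p) ^ ((U.card - (a ⊓ b).card) + (U.card - (a ⊔ b).card)) := by
              rw [e1]; congr 2; omega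
          _ = _ := by rw [pow_add, pow_add]; ring
      · have : μ b = 0 := by simp [hμ, hb]
        rw [this, mul_zero]; exact mul_nonneg (hμ0 _) (hμ0 _)
    · have : μ a = 0 := by simp [hμ, ha]
      rw [this, zero_mul]; exact mul_nonneg (hμ0 _) (hμ0 _)
  have hf := fkg _ _ μ hμ0 (hnn A) (hnn B) (hmono A hA) (hmono B hB) hlog
  have hone : ∑ s, μ s = 1 := by
    have := key (fun _ => True)
    rw [pr_true] at this
    simpa using this.symm
  rw [hone, one_mul] at hf
  rw [key A, key B, key]
  refine hf.trans (le_of_eq ?_)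
  refine Finset.sum_congr rfl fun s _ => ?_
  by_cases hA : A s <;> by_cases hB : B s <;> simp [hA, hB]

/-- Harris' inequality for an increasing and a decreasing event. -/
lemma harris_neg [Fintype E] (U : Finset E) {p : ℝ} (h0 : 0 ≤ p) (h1 : p ≤ 1)
    {A B : Finset E → Prop}
    (hA : ∀ s t, s ⊆ t → A s → A t) (hB : ∀ s t, s ⊆ t → B t → B s) :
    pr U p (fun s => A s ∧ B s) ≤ pr U p A * pr U p B := by
  have h := harris U h0 h1 (A := A) (B := fun s => ¬ B s) hA
    (fun s t hst hn hb => hn (hB s t hst hb))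
  have e1 := pr_and_add U p A B
  rw [pr_not] at h
  nlinarith

/-- The event that no `D i`, `i ∈ S`, is contained in the random set. -/
def noneIn {ι : Type*} [DecidableEq ι] (D : ι → Finset E) (S : Finset ι) (s : Finset E) : Prop :=
  ∀ i ∈ S, ¬ D i ⊆ s

/-- The (ordered, off-diagonal) correlation sum. -/
def offDiag {ι : Type*} [DecidableEq ι] (D : ι → Finset E) (p : ℝ) (i j : ι) : ℝ :=
  if i ≠ j ∧ ¬ Disjoint (D i) (D j) then p ^ (D i ∪ D j).card else 0

lemma offDiag_nonneg {ι : Type*} [DecidableEq ι] (D : ι → Finset E) {p : ℝ} (h0 : 0 ≤ p) (i j : ι) :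
    0 ≤ offDiag D p i j := by
  unfold offDiag; split_ifs
  · positivity
  · exact le_rfl

lemma noneIn_mono {ι : Type*} [DecidableEq ι] (D : ι → Finset E) (S : Finset ι) (s t : Finset E)
    (hst : s ⊆ t) (h : noneIn D S t) : noneIn D S s :=
  fun i hi hs => h i hi (hs.trans hst)

/-- Janson's inequality. -/
lemma janson [Fintype E] {ι : Type*} [DecidableEq ι] (U : Finset E) {p : ℝ} (h0 : 0 ≤ p) (h1 : p ≤ 1)
    (D : ι → Finset E) (hD : ∀ i, D i ⊆ U) (S : Finset ι) :
    pr U p (noneIn D S) ≤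
      Real.exp (-(∑ i ∈ S, p ^ (D i).card - ∑ i ∈ S, ∑ j ∈ S, offDiag D p i j)) := by
  induction S using Finset.induction_on with
  | empty =>
    have : pr U p (noneIn D ∅) = pr U p (fun _ => True) :=
      pr_congr U p fun s _ => by simp [noneIn]
    rw [this, pr_true]; simp
  | insert i S hi ih =>
    set S0 := S.filter (fun j => ¬ Disjoint (D i) (D j)) with hS0
    set S1 := S.filter (fun j => Disjoint (D i) (D j)) with hS1
    set δ : ℝ := ∑ j ∈ S0, p ^ (D i ∪ D j).card with hδ
    have hδ' : δ = ∑ j ∈ S, offDiag D p i j := by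
      rw [hδ, hS0, Finset.sum_filter]
      refine Finset.sum_congr rfl fun j hj => ?_
      have : i ≠ j := fun h => hi (h ▸ hj)
      simp [offDiag, this]
    have hN : pr U p (noneIn D (insert i S))
        = pr U p (noneIn D S) - pr U p (fun s => noneIn D S s ∧ D i ⊆ s) := by
      have := pr_and_add U p (noneIn D S) (fun s => D i ⊆ s)
      have h2 : pr U p (noneIn D (insert i S)) = pr U p (fun s => noneIn D S s ∧ ¬ D i ⊆ s) := by
        refine pr_congr U p fun s _ => ?_
        simp [noneIn, and_comm]
      rw [h2]; linarith
    have hind : pr U p (fun s => D i ⊆ s ∧ noneIn D S1 s)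
        = p ^ (D i).card * pr U p (noneIn D S1) := by
      refine pr_subset_and U p (D i) (hD i) _ ?_
      intro e he s
      unfold noneIn
      refine forall₂_congr fun j hj => not_congr ?_
      have hdj : Disjoint (D i) (D j) := (Finset.mem_filter.mp hj).2
      have hej : e ∉ D j := Finset.disjoint_left.mp hdj he
      constructor
      · intro h x hx
        rcases Finset.mem_insert.mp (h hx) with rfl | h
        · exact absurd hx hej
        · exact h
      · intro h x hx; exact Finset.mem_insert_of_mem (h hx)
    have hpair : ∀ j, pr U p (fun s => D i ∪ D j ⊆ s ∧ noneIn D S1 s)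
        ≤ p ^ (D i ∪ D j).card * pr U p (noneIn D S1) := by
      intro j
      rw [← pr_subset U p _ (Finset.union_subset (hD i) (hD j))]
      exact harris_neg U h0 h1 (fun s t hst h => h.trans hst) (noneIn_mono D S1)
    have hcover : pr U p (fun s => D i ⊆ s ∧ noneIn D S1 s) ≤
        pr U p (fun s => noneIn D S s ∧ D i ⊆ s) + δ * pr U p (noneIn D S1) := by
      have hs := pr_and_add U p (fun s => D i ⊆ s ∧ noneIn D S1 s) (noneIn D S)
      have ha : pr U p (fun s => (D i ⊆ s ∧ noneIn D S1 s) ∧ noneIn D S s) ≤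
          pr U p (fun s => noneIn D S s ∧ D i ⊆ s) :=
        pr_mono U h0 h1 fun s _ h => ⟨h.2, h.1.1⟩
      have hb : pr U p (fun s => (D i ⊆ s ∧ noneIn D S1 s) ∧ ¬ noneIn D S s) ≤
          δ * pr U p (noneIn D S1) := by
        calc _ ≤ pr U p (fun s => ∃ j ∈ S0, D i ∪ D j ⊆ s ∧ noneIn D S1 s) := by
              refine pr_mono U h0 h1 fun s _ h => ?_
              obtain ⟨⟨h1, h2⟩, h3⟩ := h
              unfold noneIn at h3
              push Not at h3
              obtain ⟨j, hj, hjs⟩ := h3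
              refine ⟨j, ?_, Finset.union_subset h1 hjs, h2⟩
              rw [hS0, Finset.mem_filter]
              refine ⟨hj, fun hd => h2 j ?_ hjs⟩
              rw [hS1, Finset.mem_filter]
              exact ⟨hj, hd⟩
          _ ≤ ∑ j ∈ S0, pr U p (fun s => D i ∪ D j ⊆ s ∧ noneIn D S1 s) :=
              pr_exists_le U h0 h1 S0 _
          _ ≤ ∑ j ∈ S0, p ^ (D i ∪ D j).card * pr U p (noneIn D S1) :=
              Finset.sum_le_sum fun j _ => hpair j
          _ = _ := by rw [hδ, Finset.sum_mul]
      linarith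
    have hS1le : pr U p (noneIn D S) ≤ pr U p (noneIn D S1) := by
      refine pr_mono U h0 h1 fun s _ h j hj => h j (Finset.mem_filter.mp hj).1
    have hnn := pr_nonneg U h0 h1 (noneIn D S)
    have hlow : pr U p (noneIn D S) * (p ^ (D i).card - δ) ≤
        pr U p (fun s => noneIn D S s ∧ D i ⊆ s) := by
      by_cases hc : 0 ≤ p ^ (D i).card - δ
      · have := mul_le_mul_of_nonneg_right hS1le hc
        rw [hind] at hcover
        nlinarith
      · have h4 := pr_nonneg U h0 h1 (fun s => noneIn D S s ∧ D i ⊆ s)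
        push Not at hc
        nlinarith
    have hstep : pr U p (noneIn D (insert i S)) ≤
        pr U p (noneIn D S) * Real.exp (-(p ^ (D i).card - δ)) := by
      have := Real.add_one_le_exp (-(p ^ (D i).card - δ))
      rw [hN]
      nlinarith
    refine hstep.trans ?_
    refine (mul_le_mul_of_nonneg_right ih (Real.exp_pos _).le).trans ?_
    rw [← Real.exp_add]
    apply Real.exp_le_exp.mpr
    rw [Finset.sum_insert hi, Finset.sum_insert hi, Finset.sum_insert hi]
    simp_rw [Finset.sum_insert hi]
    rw [Finset.sum_add_distrib, ← hδ']
    have hx : 0 ≤ ∑ j ∈ S, offDiag D p j i :=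
      Finset.sum_nonneg fun j _ => offDiag_nonneg D h0 j i
    have hy : offDiag D p i i = 0 := by simp [offDiag]
    rw [hy]
    linarith

/-- Janson's inequality with thinning. -/
lemma janson_thin [Fintype E] {ι : Type*} [DecidableEq ι] (U : Finset E) {p : ℝ} (h0 : 0 ≤ p)
    (h1 : p ≤ 1) (D : ι → Finset E) (hD : ∀ i, D i ⊆ U) (S : Finset ι) {q : ℝ} (hq0 : 0 ≤ q)
    (hq1 : q ≤ 1) :
    pr U p (noneIn D S) ≤
      Real.exp (-(q * ∑ i ∈ S, p ^ (D i).card -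
        q ^ 2 * ∑ i ∈ S, ∑ j ∈ S, offDiag D p i j)) := by
  by_cases hP : pr U p (noneIn D S) ≤ 0
  · exact hP.trans (Real.exp_pos _).le
  push Not at hP
  rw [← Real.log_le_iff_le_exp hP]
  set val : Finset ι → ℝ := fun T =>
    ∑ i ∈ T, p ^ (D i).card - ∑ i ∈ T, ∑ j ∈ T, offDiag D p i j with hval
  have hT : ∀ T ∈ S.powerset, val T ≤ -Real.log (pr U p (noneIn D S)) := by
    intro T hT
    have hTS := Finset.mem_powerset.mp hT
    have h2 : pr U p (noneIn D S) ≤ pr U p (noneIn D T) :=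
      pr_mono U h0 h1 fun s _ h j hj => h j (hTS hj)
    have h3 := (h2.trans (janson U h0 h1 D hD T))
    rw [← Real.log_le_iff_le_exp hP] at h3
    simp only [hval]
    linarith
  have havg : ∑ T ∈ S.powerset, bw S q T * val T ≤ -Real.log (pr U p (noneIn D S)) := by
    calc _ ≤ ∑ T ∈ S.powerset, bw S q T * (-Real.log (pr U p (noneIn D S))) :=
          Finset.sum_le_sum fun T hT' =>
            mul_le_mul_of_nonneg_left (hT T hT') (bw_nonneg S hq0 hq1 T)
      _ = _ := by rw [← Finset.sum_mul, sum_bw, one_mul]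
  have hlin : ∀ a : ι → ℝ, ∑ T ∈ S.powerset, bw S q T * ∑ i ∈ T, a i = q * ∑ i ∈ S, a i := by
    intro a
    have h4 : ∀ T ∈ S.powerset, bw S q T * ∑ i ∈ T, a i
        = ∑ i ∈ S, a i * (if {i} ⊆ T then bw S q T else 0) := by
      intro T hT
      have hTS := Finset.mem_powerset.mp hT
      rw [Finset.mul_sum, ← Finset.sum_subset hTS]
      · refine Finset.sum_congr rfl fun i hi => ?_
        simp [hi, mul_comm]
      · intro i _ hi; simp [hi]
    rw [Finset.sum_congr rfl h4, Finset.sum_comm, Finset.mul_sum]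
    refine Finset.sum_congr rfl fun i hi => ?_
    rw [← Finset.mul_sum]
    have := pr_subset S q {i} (by simpa using hi)
    have h5 : (∑ T ∈ S.powerset, if {i} ⊆ T then bw S q T else 0) = q ^ ({i} : Finset ι).card := by
      rw [← this]; unfold pr; congr!
    rw [h5]; simp [mul_comm]
  have hquad : ∑ T ∈ S.powerset, bw S q T * ∑ i ∈ T, ∑ j ∈ T, offDiag D p i j
      = q ^ 2 * ∑ i ∈ S, ∑ j ∈ S, offDiag D p i j := by
    have h4 : ∀ T ∈ S.powerset, bw S q T * ∑ i ∈ T, ∑ j ∈ T, offDiag D p i j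
        = ∑ i ∈ S, ∑ j ∈ S, offDiag D p i j * (if {i, j} ⊆ T then bw S q T else 0) := by
      intro T hT
      have hTS := Finset.mem_powerset.mp hT
      rw [Finset.mul_sum, ← Finset.sum_subset hTS]
      · refine Finset.sum_congr rfl fun i hi => ?_
        rw [Finset.mul_sum, ← Finset.sum_subset hTS]
        · refine Finset.sum_congr rfl fun j hj => ?_
          have : ({i, j} : Finset ι) ⊆ T := by
            intro x hx; simp at hx; rcases hx with rfl | rfl <;> assumption
          simp [this, mul_comm]
        · intro j _ hj
          have : ¬ ({i, j} : Finset ι) ⊆ T := fun h => hj (h (by simp))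
          simp [this]
      · intro i _ hi
        refine Finset.sum_eq_zero fun j _ => ?_
        have : ¬ ({i, j} : Finset ι) ⊆ T := fun h => hi (h (by simp))
        simp [this]
    rw [Finset.sum_congr rfl h4, Finset.sum_comm, Finset.mul_sum]
    refine Finset.sum_congr rfl fun i hi => ?_
    rw [Finset.sum_comm, Finset.mul_sum]
    refine Finset.sum_congr rfl fun j hj => ?_
    rw [← Finset.mul_sum]
    by_cases hij : i = j
    · subst hij; simp [offDiag]
    · have := pr_subset S q {i, j} (by
        intro x hx; simp at hx; rcases hx with rfl | rfl <;> assumption)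
      have h5 : (∑ T ∈ S.powerset, if {i, j} ⊆ T then bw S q T else 0)
          = q ^ ({i, j} : Finset ι).card := by
        rw [← this]; unfold pr; congr!
      rw [h5, Finset.card_pair hij, mul_comm]
  have hsum : ∑ T ∈ S.powerset, bw S q T * val T = q * ∑ i ∈ S, p ^ (D i).card -
        q ^ 2 * ∑ i ∈ S, ∑ j ∈ S, offDiag D p i j := by
    rw [← hquad, ← hlin, ← Finset.sum_sub_distrib]
    refine Finset.sum_congr rfl fun T _ => ?_
    simp only [hval]; ring
  rw [hsum] at havg
  linarith

/-- Bounding the probability that there is no large disjoint family of present objects. -/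
lemma packing [Fintype E] {ι : Type*} [Fintype ι] [DecidableEq ι] (U : Finset E) {p : ℝ} (h0 : 0 ≤ p)
    (h1 : p ≤ 1) (D : ι → Finset E) (hD : ∀ i, D i ⊆ U) (ℓ : ℕ) (hl : ∀ i, (D i).card = ℓ)
    (R : ι → ι → Prop) (hRs : ∀ i j, R i j → R j i)
    (hRd : ∀ i j, R i j → Disjoint (D i) (D j)) (hRi : ∀ i, ¬ R i i) (k : ℕ) (B : ℝ)
    (hB : ∀ T : Finset ι, T.card < k →
      pr U p (noneIn D (Finset.univ.filter fun i => ∀ j ∈ T, R i j)) ≤ B) :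
    pr U p (fun s => ¬ ∃ T : Finset ι, (∀ i ∈ T, D i ⊆ s) ∧
        (∀ i ∈ T, ∀ j ∈ T, i ≠ j → R i j) ∧ k ≤ T.card) ≤
      (∑ j ∈ Finset.range k, ((Fintype.card ι : ℝ) * p ^ ℓ) ^ j / (j.factorial : ℝ)) * B := by
  set Fam : Finset (Finset ι) := Finset.univ.filter
    (fun T => T.card < k ∧ ∀ i ∈ T, ∀ j ∈ T, i ≠ j → R i j) with hFam
  set Nn : Finset ι → Finset E → Prop := fun T =>
    noneIn D (Finset.univ.filter fun i => ∀ j ∈ T, R i j) with hNn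
  have hBT : ∀ T ∈ Fam, pr U p (fun s => T.biUnion D ⊆ s ∧ Nn T s) ≤ p ^ (ℓ * T.card) * B := by
    intro T hT
    obtain ⟨-, hTk, hTR⟩ := Finset.mem_filter.mp hT
    refine (harris_neg U h0 h1 (A := fun s => T.biUnion D ⊆ s) (B := Nn T)
      (fun s t hst h => h.trans hst) (noneIn_mono D _)).trans ?_
    rw [pr_subset U p _ (Finset.biUnion_subset.mpr fun i _ => hD i), Finset.card_biUnion]
    · rw [Finset.sum_congr rfl (fun i _ => hl i), Finset.sum_const, smul_eq_mul, mul_comm ℓ]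
      exact mul_le_mul_of_nonneg_left (hB T hTk) (by positivity)
    · intro i hi j hj hij
      exact hRd _ _ (hTR i hi j hj hij)
  have hB0 : 0 < k → 0 ≤ B := fun hk =>
    (pr_nonneg U h0 h1 _).trans (hB ∅ (by simpa using hk))
  calc _ ≤ pr U p (fun s => ∃ T ∈ Fam, T.biUnion D ⊆ s ∧ Nn T s) := by
        refine pr_mono U h0 h1 fun s _ hs => ?_
        set Cand : Finset (Finset ι) := Finset.univ.filter
          (fun T => (∀ i ∈ T, D i ⊆ s) ∧ ∀ i ∈ T, ∀ j ∈ T, i ≠ j → R i j) with hCand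
        have hne : Cand.Nonempty := ⟨∅, by simp [hCand]⟩
        obtain ⟨T, hT, hmax⟩ := Finset.exists_max_image Cand Finset.card hne
        obtain ⟨-, hT1, hT2⟩ := Finset.mem_filter.mp hT
        have hTk : T.card < k := by
          by_contra hge
          exact hs ⟨T, hT1, hT2, by omega⟩
        refine ⟨T, Finset.mem_filter.mpr ⟨Finset.mem_univ _, hTk, hT2⟩,
          Finset.biUnion_subset.mpr hT1, ?_⟩
        intro i hi his
        have hiR := (Finset.mem_filter.mp hi).2
        have hiT : i ∉ T := fun h => hRi i (hiR i h)
        have hins : insert i T ∈ Cand := by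
          refine Finset.mem_filter.mpr ⟨Finset.mem_univ _, ?_, ?_⟩
          · intro j hj
            rcases Finset.mem_insert.mp hj with rfl | hj
            · exact his
            · exact hT1 j hj
          · intro a ha b hb hab
            rcases Finset.mem_insert.mp ha with ha' | ha' <;>
              rcases Finset.mem_insert.mp hb with hb' | hb'
            · exact absurd (ha'.trans hb'.symm) hab
            · rw [ha']; exact hiR b hb'
            · rw [hb']; exact hRs _ _ (hiR a ha')
            · exact hT2 a ha' b hb' hab
        have := hmax _ hins
        rw [Finset.card_insert_of_notMem hiT] at this
        omega
    _ ≤ ∑ T ∈ Fam, pr U p (fun s => T.biUnion D ⊆ s ∧ Nn T s) := pr_exists_le U h0 h1 Fam _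
    _ ≤ ∑ T ∈ Fam, p ^ (ℓ * T.card) * B := Finset.sum_le_sum hBT
    _ ≤ ∑ j ∈ Finset.range k, ∑ T ∈ Finset.powersetCard j (Finset.univ : Finset ι),
          p ^ (ℓ * T.card) * B := by
        rw [← Finset.sum_biUnion]
        · refine Finset.sum_le_sum_of_subset_of_nonneg ?_ ?_
          · intro T hT
            obtain ⟨-, hTk, -⟩ := Finset.mem_filter.mp hT
            simp [hTk]
          · intro T hT _
            have hk : 0 < k := by
              simp at hT; omega
            exact mul_nonneg (by positivity) (hB0 hk)
        · intro i _ j _ hij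
          exact Finset.pairwise_disjoint_powersetCard _ hij
    _ ≤ ∑ j ∈ Finset.range k, ((Fintype.card ι : ℝ) * p ^ ℓ) ^ j / (j.factorial : ℝ) * B := by
        refine Finset.sum_le_sum fun j hj => ?_
        have hk : 0 < k := by simp at hj; omega
        have : ∀ T ∈ Finset.powersetCard j (Finset.univ : Finset ι),
            p ^ (ℓ * T.card) * B = p ^ (ℓ * j) * B := by
          intro T hT
          rw [(Finset.mem_powersetCard.mp hT).2]
        rw [Finset.sum_congr rfl this, Finset.sum_const, Finset.card_powersetCard,
          Finset.card_univ, nsmul_eq_mul, ← mul_assoc]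
        refine mul_le_mul_of_nonneg_right ?_ (hB0 hk)
        have := Nat.choose_le_pow_div (α := ℝ) j (Fintype.card ι)
        calc _ ≤ ((Fintype.card ι : ℝ) ^ j / (j.factorial : ℝ)) * p ^ (ℓ * j) :=
              mul_le_mul_of_nonneg_right this (by positivity)
          _ = _ := by rw [mul_pow, ← pow_mul]; ring
    _ = _ := by rw [Finset.sum_mul]

end Bernoulli

/-! ### The partite family of bridges -/

section Partite

variable [Fintype α]

/-- The internal vertices of a bridge. -/
abbrev Zt (a b : α) := {z : α // z ≠ a ∧ z ≠ b}

lemma card_Zt [DecidableEq α] (a b : α) (hab : a ≠ b) : Fintype.card (Zt a b) = Fintype.card α - 2 := by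
  rw [Fintype.card_subtype]
  have : (Finset.univ.filter fun z : α => z ≠ a ∧ z ≠ b) = Finset.univ \ {a, b} := by
    ext z; simp
  rw [this, Finset.card_sdiff_of_subset (Finset.subset_univ _), Finset.card_pair hab,
    Finset.card_univ]

/-- A partite family of injections. -/
structure PartFam (a b : α) (m n : ℕ) (x y : Fin n) (φ : (Zt a b → Fin m) → α → Fin n) :
    Prop where
  ha : ∀ ψ, φ ψ a = x
  hb : ∀ ψ, φ ψ b = y
  inj : ∀ ψ ψ' u w, φ ψ u = φ ψ' w → u = w
  agr : ∀ ψ ψ' (z : Zt a b), φ ψ z = φ ψ' z ↔ ψ z = ψ' z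

lemma exists_partFam (a b : α) (hab : a ≠ b) (m n : ℕ) (x y : Fin n) (hxy : x ≠ y)
    (h : (Fintype.card α - 2) * m + 2 ≤ n) :
    ∃ φ : (Zt a b → Fin m) → α → Fin n, PartFam a b m n x y φ := by
  have hc : Fintype.card (Zt a b × Fin m) ≤ Fintype.card (Zt x y) := by
    rw [Fintype.card_prod, card_Zt a b hab, card_Zt x y hxy]
    simp only [Fintype.card_fin]
    omega
  obtain ⟨g⟩ := Function.Embedding.nonempty_of_card_le hc
  let φ : (Zt a b → Fin m) → α → Fin n := fun ψ u =>
    if h : u ≠ a ∧ u ≠ b then (g (⟨u, h⟩, ψ ⟨u, h⟩)).1 else if u = a then x else y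
  have hz : ∀ ψ (z : Zt a b), φ ψ z = (g (z, ψ z)).1 := by
    intro ψ z
    simp only [φ]
    rw [dif_pos z.2]
  have ha : ∀ ψ, φ ψ a = x := by intro ψ; simp [φ]
  have hb : ∀ ψ, φ ψ b = y := by intro ψ; simp [φ, hab.symm]
  have hcase : ∀ u : α, u = a ∨ u = b ∨ ∃ z : Zt a b, u = z := by
    intro u
    by_cases h1 : u = a
    · exact Or.inl h1
    by_cases h2 : u = b
    · exact Or.inr (Or.inl h2)
    exact Or.inr (Or.inr ⟨⟨u, h1, h2⟩, rfl⟩)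
  refine ⟨φ, ha, hb, ?_, ?_⟩
  · intro ψ ψ' u w huw
    rcases hcase u with rfl | rfl | ⟨z, rfl⟩ <;> rcases hcase w with rfl | rfl | ⟨z', rfl⟩
    · rfl
    · rw [ha, hb] at huw; exact absurd huw hxy
    · rw [ha, hz] at huw; exact absurd huw.symm (g _).2.1
    · rw [ha, hb] at huw; exact absurd huw.symm hxy
    · rfl
    · rw [hb, hz] at huw; exact absurd huw.symm (g _).2.2
    · rw [ha, hz] at huw; exact absurd huw (g _).2.1
    · rw [hb, hz] at huw; exact absurd huw (g _).2.2
    · rw [hz, hz] at huw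
      have := g.injective (Subtype.ext huw)
      simp only [Prod.mk.injEq] at this
      rw [this.1]
  · intro ψ ψ' z
    rw [hz, hz]
    constructor
    · intro h
      have := g.injective (Subtype.ext h)
      simpa using this
    · intro h; rw [h]

/-- Edges of `H` other than `ab`. -/
def redE (H : SimpleGraph α) (a b : α) : Finset (Sym2 α) := H.edgeFinset.erase s(a, b)

/-- Number of edges of `H - ab` inside `X`. -/
def eIn (H : SimpleGraph α) (a b : α) (X : Finset α) : ℕ :=
  ((redE H a b).filter (fun e => ∀ u ∈ e, u ∈ X)).card

/-- The edge set of a partite bridge. -/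
def bE {m n : ℕ} (H : SimpleGraph α) (a b : α) (φ : (Zt a b → Fin m) → α → Fin n)
    (ψ : Zt a b → Fin m) : Finset (Sym2 (Fin n)) :=
  (redE H a b).image (Sym2.map (φ ψ))

variable {H : SimpleGraph α} {a b : α} {m n : ℕ} {x y : Fin n}
  {φ : (Zt a b → Fin m) → α → Fin n}

lemma PartFam.map_eq (h : PartFam a b m n x y φ) (ψ ψ' : Zt a b → Fin m) (e e' : Sym2 α)
    (he : Sym2.map (φ ψ) e = Sym2.map (φ ψ') e') : e = e' ∧ ∀ u ∈ e, φ ψ u = φ ψ' u := by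
  induction e using Sym2.ind with
  | _ u w =>
  induction e' using Sym2.ind with
  | _ u' w' =>
  simp only [Sym2.map_mk, Sym2.eq_iff] at he
  rcases he with ⟨h1, h2⟩ | ⟨h1, h2⟩
  · have e1 := h.inj _ _ _ _ h1
    have e2 := h.inj _ _ _ _ h2
    subst e1 e2
    refine ⟨rfl, ?_⟩
    intro v hv
    rcases Sym2.mem_iff.mp hv with rfl | rfl <;> assumption
  · have e1 := h.inj _ _ _ _ h1
    have e2 := h.inj _ _ _ _ h2
    subst e1 e2
    refine ⟨Sym2.eq_swap, ?_⟩
    intro v hv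
    rcases Sym2.mem_iff.mp hv with rfl | rfl <;> assumption

lemma PartFam.card_bE (h : PartFam a b m n x y φ) (ψ : Zt a b → Fin m) :
    (bE H a b φ ψ).card = (redE H a b).card := by
  unfold bE
  rw [Finset.card_image_of_injective]
  intro e e' he
  exact (h.map_eq ψ ψ e e' he).1

lemma PartFam.card_inter (h : PartFam a b m n x y φ) (ψ ψ' : Zt a b → Fin m) :
    (bE H a b φ ψ ∩ bE H a b φ ψ').card
      = eIn H a b (Finset.univ.filter fun u => φ ψ u = φ ψ' u) := by
  unfold eIn
  rw [← Finset.card_image_of_injective (f := Sym2.map (φ ψ))]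
  · congr 1
    ext q
    simp only [bE, Finset.mem_inter, Finset.mem_image, Finset.mem_filter, Finset.mem_univ, true_and]
    constructor
    · rintro ⟨⟨e, he, rfl⟩, e', he', heq⟩
      have := h.map_eq ψ ψ' e e' heq.symm
      exact ⟨e, ⟨he, this.2⟩, rfl⟩
    · rintro ⟨e, ⟨he, hag⟩, rfl⟩
      refine ⟨⟨e, he, rfl⟩, e, he, ?_⟩
      exact (Sym2.map_congr hag).symm
  · intro e e' he
    exact (h.map_eq ψ ψ e e' he).1

lemma PartFam.card_agree (h : PartFam a b m n x y φ) (hab : a ≠ b) (ψ ψ' : Zt a b → Fin m) :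
    (Finset.univ.filter fun u => φ ψ u = φ ψ' u).card - 2
      = (Finset.univ.filter fun z => ψ z = ψ' z).card := by
  have : (Finset.univ.filter fun u => φ ψ u = φ ψ' u) =
      insert a (insert b ((Finset.univ.filter fun z => ψ z = ψ' z).image Subtype.val)) := by
    ext u
    simp only [Finset.mem_filter, Finset.mem_univ, true_and, Finset.mem_insert, Finset.mem_image]
    constructor
    · intro hu
      by_cases h1 : u = a
      · exact Or.inl h1
      by_cases h2 : u = b
      · exact Or.inr (Or.inl h2)
      exact Or.inr (Or.inr ⟨⟨u, h1, h2⟩, (h.agr ψ ψ' ⟨u, h1, h2⟩).mp hu, rfl⟩)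
    · rintro (rfl | rfl | ⟨z, hz, rfl⟩)
      · rw [h.ha, h.ha]
      · rw [h.hb, h.hb]
      · exact (h.agr ψ ψ' z).mpr hz
  rw [this, Finset.card_insert_of_notMem, Finset.card_insert_of_notMem,
    Finset.card_image_of_injective _ Subtype.val_injective]
  · omega
  · intro hb
    obtain ⟨z, _, hz⟩ := Finset.mem_image.mp hb
    exact z.2.2 hz
  · intro hb
    rcases Finset.mem_insert.mp hb with hb | hb
    · exact hab hb
    · obtain ⟨z, _, hz⟩ := Finset.mem_image.mp hb
      exact z.2.1 hz

lemma redE_internal {e : Sym2 α} (he : e ∈ redE H a b) : ∃ z : Zt a b, (z : α) ∈ e := by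
  obtain ⟨hne, hE⟩ := Finset.mem_erase.mp he
  induction e using Sym2.ind with
  | _ u w =>
  rw [SimpleGraph.mem_edgeFinset, SimpleGraph.mem_edgeSet] at hE
  have huw := hE.ne
  by_contra hcon
  push Not at hcon
  have h1 : ∀ v, v ∈ s(u, w) → v = a ∨ v = b := by
    intro v hv
    by_contra hv'
    push Not at hv'
    exact hcon ⟨v, hv'⟩ hv
  have hu := h1 u (by simp)
  have hw := h1 w (by simp)
  apply hne
  rcases hu with rfl | rfl <;> rcases hw with rfl | rfl
  · exact absurd rfl huw
  · rfl
  · exact Sym2.eq_swap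
  · exact absurd rfl huw

lemma PartFam.disj (h : PartFam a b m n x y φ) (ψ ψ' : Zt a b → Fin m)
    (hR : ∀ z, ψ z ≠ ψ' z) : Disjoint (bE H a b φ ψ) (bE H a b φ ψ') := by
  rw [Finset.disjoint_left]
  intro q hq hq'
  obtain ⟨e, he, rfl⟩ := Finset.mem_image.mp hq
  obtain ⟨e', he', heq⟩ := Finset.mem_image.mp hq'
  have h2 := (h.map_eq ψ ψ' e e' heq.symm).2
  obtain ⟨z, hz⟩ := redE_internal he
  exact hR z ((h.agr ψ ψ' z).mp (h2 z hz))

lemma PartFam.sub_top (h : PartFam a b m n x y φ) (ψ : Zt a b → Fin m) :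
    bE H a b φ ψ ⊆ (⊤ : SimpleGraph (Fin n)).edgeFinset := by
  intro q hq
  obtain ⟨e, he, rfl⟩ := Finset.mem_image.mp hq
  obtain ⟨hne, hE⟩ := Finset.mem_erase.mp he
  induction e using Sym2.ind with
  | _ u w =>
  rw [SimpleGraph.mem_edgeFinset, SimpleGraph.mem_edgeSet] at hE
  rw [SimpleGraph.mem_edgeFinset, Sym2.map_mk, SimpleGraph.mem_edgeSet, SimpleGraph.top_adj]
  exact fun h3 => hE.ne (h.inj _ _ _ _ h3)

/-- Agreement generating function. -/
lemma sum_agree {Z : Type*} [Fintype Z] [DecidableEq Z] (m : ℕ) (ψ : Z → Fin m) :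
    ∑ ψ' : Z → Fin m, (m : ℝ) ^ (Finset.univ.filter fun z => ψ z = ψ' z).card
      ≤ (2 * (m : ℝ)) ^ (Fintype.card Z) := by
  have h1 : ∀ ψ' : Z → Fin m, (m : ℝ) ^ (Finset.univ.filter fun z => ψ z = ψ' z).card
      = ∏ z, (if ψ z = ψ' z then (m : ℝ) else 1) := by
    intro ψ'
    rw [Finset.prod_ite]; simp
  simp_rw [h1]
  have h2 := Finset.prod_univ_sum (fun _ : Z => (Finset.univ : Finset (Fin m)))
    (fun z i => if ψ z = i then (m : ℝ) else 1)
  rw [Fintype.piFinset_univ] at h2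
  rw [← h2, ← Finset.card_univ, ← Finset.prod_const]
  refine Finset.prod_le_prod (fun z _ => ?_) (fun z _ => ?_)
  · refine Finset.sum_nonneg fun i _ => ?_
    split_ifs <;> positivity
  · calc ∑ i, (if ψ z = i then (m : ℝ) else 1)
        ≤ ∑ i, ((if ψ z = i then (m : ℝ) else 0) + 1) := by
          refine Finset.sum_le_sum fun i _ => ?_
          split_ifs <;> simp
      _ = 2 * m := by
          rw [Finset.sum_add_distrib]; simp; ring

/-- The core estimate for partite families. -/
lemma PartFam.core (h : PartFam a b m n x y φ) (hab : a ≠ b) (hr : 1 ≤ Fintype.card α - 2)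
    {p Φ : ℝ} (hp0 : 0 < p) (hp1 : p ≤ 1) (hΦ0 : 0 < Φ) (k : ℕ) (hk : 2 * k ≤ m) (hm : 0 < m)
    (hl : 1 ≤ (redE H a b).card)
    (hΦ : ∀ X : Finset α, a ∈ X → b ∈ X → 1 ≤ eIn H a b X →
      Φ ≤ (m : ℝ) ^ (X.card - 2) * p ^ (eIn H a b X)) :
    pr (⊤ : SimpleGraph (Fin n)).edgeFinset p
      (fun s => ¬ ∃ T : Finset (Zt a b → Fin m), (∀ ψ ∈ T, bE H a b φ ψ ⊆ s) ∧
        (∀ ψ ∈ T, ∀ ψ' ∈ T, ψ ≠ ψ' → ∀ z, ψ z ≠ ψ' z) ∧ k ≤ T.card) ≤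
    (∑ j ∈ Finset.range k,
      ((m : ℝ) ^ (Fintype.card α - 2) * p ^ (redE H a b).card) ^ j / (j.factorial : ℝ)) *
      Real.exp (-(Φ / 2 ^ (3 * (Fintype.card α - 2) + 2))) := by
  set r := Fintype.card α - 2 with hrdef
  set ℓ := (redE H a b).card with hldef
  have hZ : Fintype.card (Zt a b) = r := card_Zt a b hab
  have hcardι : (Fintype.card (Zt a b → Fin m) : ℝ) = (m : ℝ) ^ r := by
    rw [Fintype.card_fun, hZ, Fintype.card_fin]; push_cast; rfl
  have hmR : (0 : ℝ) < m := by exact_mod_cast hm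
  have hne : Nonempty (Zt a b) := by
    rw [← Fintype.card_pos_iff, hZ]; omega
  set μ : ℝ := (m : ℝ) ^ r * p ^ ℓ with hμ
  have hμ0 : 0 < μ := by positivity
  have hΦμ : Φ ≤ μ := by
    have h1 : eIn H a b Finset.univ = ℓ := by simp [eIn, hldef]
    have := hΦ Finset.univ (Finset.mem_univ _) (Finset.mem_univ _) (by rw [h1]; exact hl)
    rwa [h1, Finset.card_univ] at this
  -- bound on the off-diagonal terms
  have hoff : ∀ ψ ψ' : Zt a b → Fin m, offDiag (bE H a b φ) p ψ ψ' ≤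
      p ^ (2 * ℓ) / Φ * (m : ℝ) ^ (Finset.univ.filter fun z => ψ z = ψ' z).card := by
    intro ψ ψ'
    unfold offDiag
    split_ifs with hc
    · set X := Finset.univ.filter fun u => φ ψ u = φ ψ' u with hX
      have hinter := h.card_inter (H := H) ψ ψ'
      have hag := h.card_agree hab ψ ψ'
      rw [← hX] at hinter hag
      have hpos : 1 ≤ eIn H a b X := by
        rw [← hinter]
        by_contra hlt
        have : (bE H a b φ ψ ∩ bE H a b φ ψ').card = 0 := by omega
        exact hc.2 (Finset.disjoint_iff_inter_eq_empty.mpr (Finset.card_eq_zero.mp this))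
      have hΦX := hΦ X (by simp [hX, h.ha]) (by simp [hX, h.hb]) hpos
      have hcu := Finset.card_union_add_card_inter (bE H a b φ ψ) (bE H a b φ ψ')
      rw [h.card_bE, h.card_bE, hinter, ← hldef] at hcu
      rw [← hag]
      rw [div_mul_eq_mul_div, le_div_iff₀ hΦ0]
      calc p ^ (bE H a b φ ψ ∪ bE H a b φ ψ').card * Φ
          ≤ p ^ (bE H a b φ ψ ∪ bE H a b φ ψ').card *
            ((m : ℝ) ^ (X.card - 2) * p ^ (eIn H a b X)) :=
            mul_le_mul_of_nonneg_left hΦX (by positivity)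
        _ = p ^ ((bE H a b φ ψ ∪ bE H a b φ ψ').card + eIn H a b X) * (m : ℝ) ^ (X.card - 2) := by
            rw [pow_add]; ring
        _ = p ^ (2 * ℓ) * (m : ℝ) ^ (X.card - 2) := by rw [hcu, two_mul]
    · positivity
  have hΔ : ∀ S : Finset (Zt a b → Fin m), ∑ ψ ∈ S, ∑ ψ' ∈ S, offDiag (bE H a b φ) p ψ ψ' ≤
      μ ^ 2 * 2 ^ r / Φ := by
    intro S
    have hnn := fun ψ ψ' => offDiag_nonneg (bE H a b φ) hp0.le ψ ψ'
    calc _ ≤ ∑ ψ, ∑ ψ', offDiag (bE H a b φ) p ψ ψ' := by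
          refine (Finset.sum_le_sum fun ψ _ => Finset.sum_le_univ_sum_of_nonneg (hnn ψ)).trans ?_
          exact Finset.sum_le_univ_sum_of_nonneg fun ψ => Finset.sum_nonneg fun ψ' _ => hnn ψ ψ'
      _ ≤ ∑ ψ, ∑ ψ' : Zt a b → Fin m, p ^ (2 * ℓ) / Φ *
            (m : ℝ) ^ (Finset.univ.filter fun z => ψ z = ψ' z).card :=
          Finset.sum_le_sum fun ψ _ => Finset.sum_le_sum fun ψ' _ => hoff ψ ψ'
      _ ≤ ∑ ψ : Zt a b → Fin m, p ^ (2 * ℓ) / Φ * (2 * (m : ℝ)) ^ r := by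
          refine Finset.sum_le_sum fun ψ _ => ?_
          rw [← Finset.mul_sum]
          have := sum_agree m ψ
          rw [hZ] at this
          exact mul_le_mul_of_nonneg_left this (by positivity)
      _ = μ ^ 2 * 2 ^ r / Φ := by
          rw [Finset.sum_const, nsmul_eq_mul, Finset.card_univ, hcardι, hμ, mul_pow, mul_pow,
            pow_mul']
          ring
  have hpk := packing (⊤ : SimpleGraph (Fin n)).edgeFinset hp0.le hp1 (bE H a b φ)
    (fun ψ => h.sub_top ψ) ℓ (fun ψ => h.card_bE ψ) (fun ψ ψ' => ∀ z, ψ z ≠ ψ' z)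
    (fun _ _ hR z => (hR z).symm) (fun ψ ψ' hR => h.disj ψ ψ' hR)
    (fun ψ hR => hR hne.some rfl) k (Real.exp (-(Φ / 2 ^ (3 * r + 2)))) ?_
  · rw [hcardι] at hpk
    exact hpk
  · intro T hT
    set S := Finset.univ.filter fun ψ : Zt a b → Fin m => ∀ ψ' ∈ T, ∀ z, ψ z ≠ ψ' z with hS
    have hScard : ((m : ℝ) / 2) ^ r ≤ S.card := by
      have hSeq : S = Fintype.piFinset
          (fun z => (Finset.univ : Finset (Fin m)) \ T.image (fun ψ' => ψ' z)) := by
        ext ψ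
        simp only [hS, Finset.mem_filter, Finset.mem_univ, true_and, Fintype.mem_piFinset,
          Finset.mem_sdiff, Finset.mem_image, not_exists, not_and]
        constructor
        · intro h3 z ψ' hψ' h4; exact h3 ψ' hψ' z h4.symm
        · intro h3 ψ' hψ' z h4; exact h3 z ψ' hψ' h4.symm
      rw [hSeq, Fintype.card_piFinset]
      push_cast
      rw [← hZ, ← Finset.card_univ, ← Finset.prod_const]
      refine Finset.prod_le_prod (fun z _ => by positivity) (fun z _ => ?_)
      rw [Finset.card_sdiff_of_subset (Finset.subset_univ _), Finset.card_univ, Fintype.card_fin]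
      have h5 : (T.image (fun ψ' => ψ' z)).card ≤ T.card := Finset.card_image_le
      have h6 : m ≤ 2 * (m - (T.image (fun ψ' => ψ' z)).card) := by omega
      have h7 : (m : ℝ) ≤ 2 * ((m - (T.image (fun ψ' => ψ' z)).card : ℕ) : ℝ) := by
        exact_mod_cast h6
      linarith
    set q : ℝ := Φ / (μ * 2 ^ (2 * r + 1)) with hq
    have hq0 : 0 ≤ q := by positivity
    have hq1 : q ≤ 1 := by
      rw [hq, div_le_one (by positivity)]
      have : (1 : ℝ) ≤ 2 ^ (2 * r + 1) := one_le_pow₀ (by norm_num)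
      nlinarith
    have hjt := janson_thin _ hp0.le hp1 (bE H a b φ) (fun ψ => h.sub_top ψ) S hq0 hq1
    suffices hsuff : pr (⊤ : SimpleGraph (Fin n)).edgeFinset p (noneIn (bE H a b φ) S) ≤
        Real.exp (-(Φ / 2 ^ (3 * r + 2))) by convert hsuff
    refine hjt.trans ?_
    apply Real.exp_le_exp.mpr
    rw [neg_le_neg_iff]
    have hsum : μ / 2 ^ r ≤ ∑ ψ ∈ S, p ^ (bE H a b φ ψ).card := by
      rw [Finset.sum_congr rfl (fun ψ _ => by rw [h.card_bE (H := H) ψ]), Finset.sum_const,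
        nsmul_eq_mul]
      calc μ / 2 ^ r = ((m : ℝ) / 2) ^ r * p ^ ℓ := by rw [hμ, div_pow]; ring
        _ ≤ _ := mul_le_mul_of_nonneg_right hScard (by positivity)
    have h8 : q * (μ / 2 ^ r) ≤ q * ∑ ψ ∈ S, p ^ (bE H a b φ ψ).card :=
      mul_le_mul_of_nonneg_left hsum hq0
    have h9 : q ^ 2 * ∑ ψ ∈ S, ∑ ψ' ∈ S, offDiag (bE H a b φ) p ψ ψ' ≤
        q ^ 2 * (μ ^ 2 * 2 ^ r / Φ) := mul_le_mul_of_nonneg_left (hΔ S) (by positivity)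
    have h10 : q * (μ / 2 ^ r) - q ^ 2 * (μ ^ 2 * 2 ^ r / Φ) = Φ / 2 ^ (3 * r + 2) := by
      rw [hq]
      have e1 : (2 : ℝ) ^ (2 * r + 1) = (2 ^ r) ^ 2 * 2 := by rw [pow_succ, pow_mul']
      have e2 : (2 : ℝ) ^ (3 * r + 2) = (2 ^ r) ^ 3 * 4 := by
        rw [pow_add, pow_mul']; norm_num
      rw [e1, e2]
      have : (0 : ℝ) < 2 ^ r := by positivity
      field_simp
      ring
    linarith

/-- A disjoint family of partite bridges gives a lower bound on `sigmaB`. -/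
lemma PartFam.sigma_ge (h : PartFam a b m n x y φ) (hab : H.Adj a b)
    (hr : 1 ≤ Fintype.card α - 2) (s : Finset (Sym2 (Fin n))) (k : ℕ)
    (T : Finset (Zt a b → Fin m)) (hT : ∀ ψ ∈ T, bE H a b φ ψ ⊆ s)
    (hR : ∀ ψ ∈ T, ∀ ψ' ∈ T, ψ ≠ ψ' → ∀ z, ψ z ≠ ψ' z) (hk : k ≤ T.card) :
    k ≤ sigmaB H (SimpleGraph.fromEdgeSet (↑s : Set (Sym2 (Fin n)))) x y := by
  set G := SimpleGraph.fromEdgeSet (↑s : Set (Sym2 (Fin n))) with hG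
  have hne : Nonempty (Zt a b) := by
    rw [← Fintype.card_pos_iff, card_Zt a b hab.ne]; omega
  have hadj : ∀ ψ ∈ T, ∀ u w, H.Adj u w → (bridgeHost G x y).Adj (φ ψ u) (φ ψ w) := by
    intro ψ hψ u w huw
    have hne : φ ψ u ≠ φ ψ w := fun h3 => huw.ne (h.inj _ _ _ _ h3)
    unfold bridgeHost
    rw [SimpleGraph.sup_adj]
    by_cases he : s(u, w) = s(a, b)
    · right
      rw [SimpleGraph.fromEdgeSet_adj]
      refine ⟨?_, hne⟩
      rw [Set.mem_singleton_iff, ← Sym2.map_mk, he, Sym2.map_mk, h.ha, h.hb]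
    · left
      rw [hG, SimpleGraph.fromEdgeSet_adj]
      refine ⟨?_, hne⟩
      apply hT ψ hψ
      unfold bE
      rw [← Sym2.map_mk]
      apply Finset.mem_image_of_mem
      refine Finset.mem_erase.mpr ⟨he, ?_⟩
      rw [SimpleGraph.mem_edgeFinset]; exact huw
  let cp : ∀ ψ ∈ T, SimpleGraph.Copy H (bridgeHost G x y) := fun ψ hψ =>
    ⟨⟨φ ψ, fun {u w} huw => hadj ψ hψ u w huw⟩, fun u w huw => h.inj ψ ψ u w huw⟩
  let Ks : (Zt a b → Fin m) → (bridgeHost G x y).Subgraph := fun ψ =>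
    if hψ : ψ ∈ T then (cp ψ hψ).toSubgraph else ⊥
  have hKs : ∀ ψ (hψ : ψ ∈ T), Ks ψ = (cp ψ hψ).toSubgraph := fun ψ hψ => dif_pos hψ
  have hverts : ∀ ψ ∈ T, (Ks ψ).verts = Set.range (φ ψ) := by
    intro ψ hψ
    rw [hKs ψ hψ]
    simp [SimpleGraph.Copy.toSubgraph, cp]
  have hcopy : ∀ ψ ∈ T, IsBridgeCopy H G x y (Ks ψ) := by
    intro ψ hψ
    rw [hKs ψ hψ]
    refine ⟨⟨(cp ψ hψ).isoToSubgraph⟩, ?_⟩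
    rw [SimpleGraph.Subgraph.mem_edgeSet]
    simp only [SimpleGraph.Copy.toSubgraph, SimpleGraph.Subgraph.map_adj, Relation.Map,
      SimpleGraph.Subgraph.top_adj]
    exact ⟨a, b, hab, h.ha ψ, h.hb ψ⟩
  have hdisj : ∀ ψ ∈ T, ∀ ψ' ∈ T, ψ ≠ ψ' →
      ((Ks ψ).verts ∩ (Ks ψ').verts : Set (Fin n)) ⊆ {x, y} := by
    intro ψ hψ ψ' hψ' hne
    rw [hverts ψ hψ, hverts ψ' hψ']
    rintro v ⟨⟨u, rfl⟩, w, hw⟩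
    have huw := h.inj _ _ _ _ hw
    subst huw
    by_cases h1 : w = a
    · left; rw [h1, h.ha]
    by_cases h2 : w = b
    · right; rw [h2, h.hb]; rfl
    exact absurd ((h.agr ψ ψ' ⟨w, h1, h2⟩).mp hw.symm) (hR ψ hψ ψ' hψ' hne _)
  have hinj : Set.InjOn Ks ↑T := by
    intro ψ hψ ψ' hψ' heq
    by_contra hne'
    obtain ⟨z⟩ := hne
    have hv : (Set.range (φ ψ)) = Set.range (φ ψ') := by
      rw [← hverts ψ hψ, ← hverts ψ' hψ', heq]
    obtain ⟨w, hw⟩ : φ ψ z ∈ Set.range (φ ψ') := hv ▸ Set.mem_range_self _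
    have hwz := h.inj _ _ _ _ hw
    subst hwz
    exact hR ψ hψ ψ' hψ' hne' z ((h.agr ψ ψ' z).mp hw.symm)
  refine hk.trans ?_
  unfold sigmaB
  apply le_csSup
  · refine ⟨Nat.card ((bridgeHost G x y).Subgraph), ?_⟩
    rintro j ⟨T', -, -, rfl⟩
    have : Finite ((bridgeHost G x y).Subgraph) := inferInstance
    have := Fintype.ofFinite ((bridgeHost G x y).Subgraph)
    rw [Nat.card_eq_fintype_card]
    exact Finset.card_le_univ T'
  · refine ⟨T.image Ks, ?_, ?_, Finset.card_image_of_injOn hinj⟩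
    · intro K hK
      obtain ⟨ψ, hψ, rfl⟩ := Finset.mem_image.mp hK
      exact hcopy ψ hψ
    · intro K hK K' hK' hKK
      obtain ⟨ψ, hψ, rfl⟩ := Finset.mem_image.mp hK
      obtain ⟨ψ', hψ', rfl⟩ := Finset.mem_image.mp hK'
      exact hdisj ψ hψ ψ' hψ' (fun h => hKK (by rw [h]))

/-- Probability that `sigmaB` is small for a fixed pair. -/
lemma sigma_core (hab : H.Adj a b) (hr : 1 ≤ Fintype.card α - 2) (m n : ℕ) (x y : Fin n)
    (hxy : x ≠ y) (hn : (Fintype.card α - 2) * m + 2 ≤ n)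
    {p Φ : ℝ} (hp0 : 0 < p) (hp1 : p ≤ 1) (hΦ0 : 0 < Φ) (k : ℕ) (hk : 2 * k ≤ m) (hm : 0 < m)
    (hl : 1 ≤ (redE H a b).card)
    (hΦ : ∀ X : Finset α, a ∈ X → b ∈ X → 1 ≤ eIn H a b X →
      Φ ≤ (m : ℝ) ^ (X.card - 2) * p ^ (eIn H a b X)) :
    pr (⊤ : SimpleGraph (Fin n)).edgeFinset p
      (fun s => ¬ k ≤ sigmaB H (SimpleGraph.fromEdgeSet (↑s : Set (Sym2 (Fin n)))) x y) ≤
    (∑ j ∈ Finset.range k,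
      ((m : ℝ) ^ (Fintype.card α - 2) * p ^ (redE H a b).card) ^ j / (j.factorial : ℝ)) *
      Real.exp (-(Φ / 2 ^ (3 * (Fintype.card α - 2) + 2))) := by
  obtain ⟨φ, h⟩ := exists_partFam a b hab.ne m n x y hxy hn
  refine le_trans (pr_mono _ hp0.le hp1 ?_) (h.core hab.ne hr hp0 hp1 hΦ0 k hk hm hl hΦ)
  rintro s - hs ⟨T, h1, h2, h3⟩
  exact hs (h.sigma_ge hab hr s k T h1 h2 h3)

end Partite

section Structure

variable [Fintype α]

lemma eCount_eq (H : SimpleGraph α) : eCount H = H.edgeFinset.card := by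
  unfold eCount
  rw [Nat.card_eq_fintype_card, SimpleGraph.edgeFinset_card]

lemma redE_card (H : SimpleGraph α) {a b : α} (hab : H.Adj a b) :
    (redE H a b).card = eCount H - 1 := by
  rw [eCount_eq]
  unfold redE
  rw [Finset.card_erase_of_mem]
  rw [SimpleGraph.mem_edgeFinset]; exact hab

lemma eIn_univ (H : SimpleGraph α) (a b : α) : eIn H a b Finset.univ = (redE H a b).card := by
  simp [eIn]

lemma subDensity2_top (H : SimpleGraph α) : subDensity2 (⊤ : H.Subgraph) = d2 H := by
  unfold subDensity2 d2 eCount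
  rw [SimpleGraph.Subgraph.edgeSet_top, SimpleGraph.Subgraph.verts_top]
  simp

lemma m2_eq (H : SimpleGraph α) (hH : Strictly2Balanced H) : m2 H = d2 H := by
  unfold m2
  have : IsGreatest {x : ℝ | ∃ K : H.Subgraph, x = subDensity2 K} (d2 H) := by
    refine ⟨⟨⊤, (subDensity2_top H).symm⟩, ?_⟩
    rintro x ⟨K, rfl⟩
    by_cases hK : K = ⊤
    · rw [hK, subDensity2_top]
    · exact (hH.2 K hK).le
  exact this.csSup_eq

lemma bal (H : SimpleGraph α) (hH : Strictly2Balanced H) (X : Finset α) (E : Finset (Sym2 α))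
    (hE : E ⊆ H.edgeFinset) (hX : ∀ e ∈ E, ∀ u ∈ e, u ∈ X) :
    density2 X.card E.card ≤ d2 H ∧
    ((X = Finset.univ ∧ E = H.edgeFinset) ∨ density2 X.card E.card < d2 H) := by
  let K : H.Subgraph :=
    { verts := ↑X
      Adj := fun u w => s(u, w) ∈ E
      adj_sub := fun {u w} h => by
        have := hE h
        rwa [SimpleGraph.mem_edgeFinset, SimpleGraph.mem_edgeSet] at this
      edge_vert := fun {u w} h => hX _ h u (Sym2.mem_mk_left u w)
      symm := ⟨fun u w h => by rwa [Sym2.eq_swap]⟩ }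
  have hKe : K.edgeSet = ↑E := by
    ext e
    induction e with
    | _ u w => rfl
  have hKv : K.verts = ↑X := rfl
  have hd : subDensity2 K = density2 X.card E.card := by
    unfold subDensity2
    rw [hKe, hKv]
    simp
  by_cases hK : K = ⊤
  · constructor
    · rw [← hd, hK, subDensity2_top]
    · left
      constructor
      · rw [← Finset.coe_eq_univ, ← hKv, hK]; rfl
      · rw [← Finset.coe_inj, ← hKe, hK]
        simp
  · have := hH.2 K hK
    rw [hd] at this
    exact ⟨this.le, Or.inr this⟩

lemma d2_pos (H : SimpleGraph α) (hH : Strictly2Balanced H) : 0 < d2 H := by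
  rcases (bal H hH ∅ ∅ (by simp) (by simp)).2 with h | h
  · exfalso
    have h3 := hH.1
    rw [Nat.card_eq_fintype_card, ← Finset.card_univ, ← h.1] at h3
    simp at h3
  · simpa [density2] using h

lemma d2_eq (H : SimpleGraph α) (hH : Strictly2Balanced H) :
    d2 H = ((eCount H : ℝ) - 1) / ((Fintype.card α : ℝ) - 2) := by
  unfold d2 density2
  rw [if_pos hH.1, Nat.card_eq_fintype_card]

lemma card3 (H : SimpleGraph α) (hH : Strictly2Balanced H) : 3 ≤ Fintype.card α := by
  have := hH.1
  rwa [Nat.card_eq_fintype_card] at this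

lemma two_le_eCount (H : SimpleGraph α) (hH : Strictly2Balanced H) : 2 ≤ eCount H := by
  have h := d2_pos H hH
  rw [d2_eq H hH] at h
  have h3 : (3 : ℝ) ≤ Fintype.card α := by exact_mod_cast card3 H hH
  have h4 : (0 : ℝ) < (eCount H : ℝ) - 1 := by
    by_contra hc
    exact absurd h (not_lt.mpr (div_nonpos_of_nonpos_of_nonneg (by linarith) (by linarith)))
  have : (1 : ℝ) < eCount H := by linarith
  exact_mod_cast this

lemma rho_pos (H : SimpleGraph α) (hH : Strictly2Balanced H) : 0 < rho H := by
  unfold rho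
  have h1 := two_le_eCount H hH
  have h2 : 0 < autCount H := by
    unfold autCount
    have : Finite (H ≃g H) := DFunLike.finite _
    exact Nat.card_pos
  have h1' : (0 : ℝ) < eCount H := by exact_mod_cast (by omega)
  have h2' : (0 : ℝ) < autCount H := by exact_mod_cast h2
  positivity

lemma balance (H : SimpleGraph α) (hH : Strictly2Balanced H) {a b : α} (hab : H.Adj a b)
    (X : Finset α) (ha : a ∈ X) (hb : b ∈ X) (hX : X ≠ Finset.univ) (he : 1 ≤ eIn H a b X) :
    3 ≤ X.card ∧ (Fintype.card α - 2) * eIn H a b X + 1 ≤ (eCount H - 1) * (X.card - 2) := by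
  set F := (redE H a b).filter (fun e => ∀ u ∈ e, u ∈ X) with hF
  have hFc : eIn H a b X = F.card := rfl
  have hnot : s(a, b) ∉ F := by
    simp [hF, redE]
  have hcard : (insert s(a, b) F).card = F.card + 1 := Finset.card_insert_of_notMem hnot
  have hsub : insert s(a, b) F ⊆ H.edgeFinset := by
    intro e he
    rcases Finset.mem_insert.mp he with rfl | he
    · rw [SimpleGraph.mem_edgeFinset]; exact hab
    · exact Finset.mem_of_mem_erase (Finset.mem_filter.mp he).1
  have hin : ∀ e ∈ insert s(a, b) F, ∀ u ∈ e, u ∈ X := by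
    intro e he u hu
    rcases Finset.mem_insert.mp he with rfl | he
    · rcases Sym2.mem_iff.mp hu with rfl | rfl <;> assumption
    · exact (Finset.mem_filter.mp he).2 u hu
  have hX3 : 3 ≤ X.card := by
    rw [hFc] at he
    obtain ⟨e, heF⟩ := Finset.card_pos.mp he
    have h1 := (Finset.mem_filter.mp heF).2
    have h2 := (Finset.mem_filter.mp heF).1
    by_contra hlt
    have h2' : ({a, b} : Finset α).card = 2 := Finset.card_pair hab.ne
    have hXe : ({a, b} : Finset α) = X := by
      apply Finset.eq_of_subset_of_card_le
      · intro u hu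
        rcases Finset.mem_insert.mp hu with rfl | hu
        · exact ha
        · rw [Finset.mem_singleton.mp hu]; exact hb
      · omega
    have h3 := Finset.mem_erase.mp h2
    induction e with
    | _ u w =>
      have hu := h1 u (Sym2.mem_mk_left _ _)
      have hw := h1 w (Sym2.mem_mk_right _ _)
      have hadj : H.Adj u w := by simpa using h3.2
      rw [← hXe] at hu hw
      simp only [Finset.mem_insert, Finset.mem_singleton] at hu hw
      rcases hu with rfl | rfl <;> rcases hw with rfl | rfl
      · exact hadj.ne rfl
      · exact h3.1 rfl
      · exact h3.1 Sym2.eq_swap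
      · exact hadj.ne rfl
  refine ⟨hX3, ?_⟩
  rcases (bal H hH X _ hsub hin).2 with h | h
  · exact absurd h.1 hX
  · rw [d2_eq H hH, hcard] at h
    unfold density2 at h
    rw [if_pos hX3] at h
    have h3 := card3 H hH
    have h2 := two_le_eCount H hH
    have h3' : (3 : ℝ) ≤ Fintype.card α := by exact_mod_cast h3
    have hX3' : (3 : ℝ) ≤ X.card := by exact_mod_cast hX3
    rw [div_lt_div_iff₀ (by linarith) (by linarith)] at h
    have : (Fintype.card α - 2) * eIn H a b X < (eCount H - 1) * (X.card - 2) := by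
      rw [hFc]
      have : (((Fintype.card α - 2 : ℕ) * F.card : ℕ) : ℝ) <
          (((eCount H - 1 : ℕ) * (X.card - 2 : ℕ) : ℕ) : ℝ) := by
        push_cast [Nat.cast_sub (show 2 ≤ Fintype.card α by omega),
          Nat.cast_sub (show 1 ≤ eCount H by omega), Nat.cast_sub (show 2 ≤ X.card by omega)]
        push_cast at h
        linarith
      exact_mod_cast this
    omega

lemma caseA (H : SimpleGraph α) (hH : Strictly2Balanced H) (hPT : NotPathOrTriangle H)
    {u v w : α} (huv : H.Adj u v) (huw : H.Adj u w) (hvw : v ≠ w) :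
    Fintype.card α - 2 + 1 ≤ eCount H - 1 := by
  have hX : ({v, u, w} : Finset α).card = 3 := by
    rw [Finset.card_eq_three]
    exact ⟨v, u, w, huv.ne.symm, hvw, huw.ne, rfl⟩
  have hne : s(u, v) ≠ s(u, w) := by
    intro h
    rcases Sym2.eq_iff.mp h with h | h
    · exact hvw h.2
    · exact huw.ne h.1
  have hE : ({s(u, v), s(u, w)} : Finset (Sym2 α)).card = 2 := Finset.card_pair hne
  have h3 := card3 H hH
  have h2 := two_le_eCount H hH
  rcases (bal H hH {v, u, w} {s(u, v), s(u, w)} (by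
      intro e he
      simp only [Finset.mem_insert, Finset.mem_singleton] at he
      rw [SimpleGraph.mem_edgeFinset]
      rcases he with rfl | rfl
      · exact huv
      · exact huw) (by
      intro e he x hx
      simp only [Finset.mem_insert, Finset.mem_singleton] at he
      rcases he with rfl | rfl <;> rcases Sym2.mem_iff.mp hx with rfl | rfl <;> simp)).2 with h | h
  · exfalso
    apply hPT.1
    have hadj : ∀ x y, H.Adj x y ↔ s(x, y) = s(u, v) ∨ s(x, y) = s(u, w) := by
      intro x y
      rw [← SimpleGraph.mem_edgeSet, ← SimpleGraph.mem_edgeFinset, ← h.2]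
      simp
    let f : Fin 3 → α := ![v, u, w]
    have hbij : Function.Bijective f := by
      constructor
      · intro i j hij
        fin_cases i <;> fin_cases j <;>
          simp_all [f, huv.ne, huw.ne, huv.ne.symm, huw.ne.symm, hvw.symm]
      · intro x
        have : x ∈ ({v, u, w} : Finset α) := by rw [h.1]; simp
        simp only [Finset.mem_insert, Finset.mem_singleton] at this
        rcases this with rfl | rfl | rfl
        · exact ⟨0, rfl⟩
        · exact ⟨1, rfl⟩
        · exact ⟨2, rfl⟩
    have hvu := huv.ne.symm
    have hwu := huw.ne.symm
    have huv' := huv.ne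
    have huw' := huw.ne
    have hwv := hvw.symm
    refine ⟨SimpleGraph.Iso.symm ⟨Equiv.ofBijective f hbij, ?_⟩⟩
    intro i j
    rw [hadj, SimpleGraph.pathGraph_adj]
    fin_cases i <;> fin_cases j <;>
      simp [f, hvu, hwu, huv', huw', hwv, hvw]
  · rw [hX, hE, d2_eq H hH] at h
    unfold density2 at h
    have h3' : (3 : ℝ) ≤ Fintype.card α := by exact_mod_cast h3
    rw [if_pos le_rfl, lt_div_iff₀ (by linarith)] at h
    have : (Fintype.card α : ℝ) < eCount H + 1 := by push_cast at h; linarith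
    have : Fintype.card α < eCount H + 1 := by exact_mod_cast this
    omega

lemma caseB (H : SimpleGraph α) (hH : Strictly2Balanced H)
    (hno : ¬ ∃ u v w, H.Adj u v ∧ H.Adj u w ∧ v ≠ w) : d2 H = 1 / 2 := by
  have h3 := card3 H hH
  have h2 := two_le_eCount H hH
  have h3' : (3 : ℝ) ≤ Fintype.card α := by exact_mod_cast h3
  push Not at hno
  have hdeg : 2 * eCount H ≤ Fintype.card α := by
    rw [eCount_eq, ← SimpleGraph.sum_degrees_eq_twice_card_edges]
    calc ∑ v, H.degree v ≤ ∑ v : α, 1 := by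
          refine Finset.sum_le_sum fun v _ => ?_
          rw [← SimpleGraph.card_neighborFinset_eq_degree]
          refine Finset.card_le_one.mpr ?_
          intro x hx y hy
          exact hno v x y (by simpa using hx) (by simpa using hy)
      _ = _ := by simp
  have hle : d2 H ≤ 1 / 2 := by
    rw [d2_eq H hH, div_le_div_iff₀ (by linarith) (by norm_num)]
    have : (2 * eCount H : ℝ) ≤ Fintype.card α := by exact_mod_cast hdeg
    linarith
  refine le_antisymm hle ?_
  rw [eCount_eq] at h2
  obtain ⟨e, he, e', he', hee⟩ := Finset.one_lt_card.mp (by omega : 1 < H.edgeFinset.card)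
  induction e with
  | _ u v =>
  induction e' with
  | _ x y =>
    have huv : H.Adj u v := by simpa using he
    have hxy : H.Adj x y := by simpa using he'
    have h1 : u ≠ x := by
      rintro rfl
      exact hee (by rw [hno _ _ _ huv hxy])
    have h2 : u ≠ y := by
      rintro rfl
      exact hee (by rw [hno _ _ _ huv hxy.symm, Sym2.eq_swap])
    have h3 : v ≠ x := by
      rintro rfl
      exact hee (by rw [hno _ _ _ huv.symm hxy, Sym2.eq_swap])
    have h4 : v ≠ y := by
      rintro rfl
      exact hee (by rw [hno _ _ _ huv.symm hxy.symm])
    have hX : ({u, v, x, y} : Finset α).card = 4 := by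
      rw [Finset.card_insert_of_notMem, Finset.card_insert_of_notMem, Finset.card_pair hxy.ne]
      · simp [h3, h4]
      · simp [h1, h2, huv.ne]
    have hE : ({s(u, v), s(x, y)} : Finset (Sym2 α)).card = 2 := Finset.card_pair hee
    have := (bal H hH {u, v, x, y} {s(u, v), s(x, y)} (by
      intro e he
      simp only [Finset.mem_insert, Finset.mem_singleton] at he
      rcases he with rfl | rfl <;> assumption) (by
      intro e he z hz
      simp only [Finset.mem_insert, Finset.mem_singleton] at he
      rcases he with rfl | rfl <;> rcases Sym2.mem_iff.mp hz with rfl | rfl <;> simp)).1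
    rw [hX, hE] at this
    unfold density2 at this
    norm_num at this
    linarith

end Structure

section Numeric

lemma num_small {N p θ δ : ℝ} {r l m y f : ℕ} (hN : 1 ≤ N) (hm : (m : ℝ) ≤ N)
    (hp0 : 0 < p) (hl : 0 < l) (hθ : θ * l = r) (hδ : δ * l ≤ 1 / l) (hδ0 : 0 ≤ δ)
    (hp : p ≤ N ^ (-θ + δ)) (hy : y ≤ r) (hf : f ≤ l) (hb : r * f + 1 ≤ l * y) :
    (m : ℝ) ^ r * p ^ l ≤ (m : ℝ) ^ y * p ^ f := by
  have hN0 : (0 : ℝ) < N := by linarith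
  have hlR : (0 : ℝ) < l := by exact_mod_cast hl
  have key : (m : ℝ) ^ (r - y) * p ^ (l - f) ≤ 1 := by
    calc (m : ℝ) ^ (r - y) * p ^ (l - f) ≤ N ^ (r - y) * (N ^ (-θ + δ)) ^ (l - f) := by
          gcongr
      _ = N ^ (((r - y : ℕ) : ℝ) + (-θ + δ) * ((l - f : ℕ) : ℝ)) := by
          rw [Real.rpow_add hN0 (_ : ℝ) (_ * _), Real.rpow_natCast, Real.rpow_mul hN0.le,
            Real.rpow_natCast]
      _ ≤ 1 := by
          apply Real.rpow_le_one_of_one_le_of_nonpos hN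
          rw [Nat.cast_sub hy, Nat.cast_sub hf]
          have hb' : (r : ℝ) * f + 1 ≤ l * y := by exact_mod_cast hb
          have h1 : θ * f + 1 / l ≤ y := by
            have : θ = r / l := by field_simp; linarith
            rw [this]
            have : (r : ℝ) / l * f + 1 / l = (r * f + 1) / l := by ring
            rw [this, div_le_iff₀ hlR]; linarith
          have h2 : 0 ≤ δ * f := by positivity
          nlinarith
  calc (m : ℝ) ^ r * p ^ l = (m : ℝ) ^ y * p ^ f * ((m : ℝ) ^ (r - y) * p ^ (l - f)) := by
        conv_lhs => rw [← Nat.add_sub_cancel' hy, ← Nat.add_sub_cancel' hf, pow_add, pow_add]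
        ring
    _ ≤ (m : ℝ) ^ y * p ^ f * 1 := by gcongr
    _ = _ := mul_one _

lemma num_mu {N p θ δ : ℝ} {r l m : ℕ} (hN : 1 ≤ N) (hm : (m : ℝ) ≤ N)
    (hp0 : 0 < p) (hθ : θ * l = r) (hδ : δ * l ≤ 1 / 2)
    (hp : p ≤ N ^ (-θ + δ)) :
    (m : ℝ) ^ r * p ^ l ≤ N ^ (1 / 2 : ℝ) := by
  have hN0 : (0 : ℝ) < N := by linarith
  calc (m : ℝ) ^ r * p ^ l ≤ N ^ r * (N ^ (-θ + δ)) ^ l := by gcongr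
    _ = N ^ ((r : ℝ) + (-θ + δ) * (l : ℝ)) := by
        rw [Real.rpow_add hN0 (_ : ℝ) (_ * _), Real.rpow_natCast, Real.rpow_mul hN0.le,
            Real.rpow_natCast]
    _ ≤ _ := by
        apply Real.rpow_le_rpow_of_exponent_le hN
        nlinarith

lemma sum_small {μ ε : ℝ} {k : ℕ} (hμ : 0 ≤ μ) (hε : 0 < ε) (hε1 : ε ≤ 1) (hk : (k : ℝ) ≤ ε * μ) :
    ∑ j ∈ Finset.range k, μ ^ j / (j.factorial : ℝ) ≤ Real.exp (μ * (Real.negMulLog ε + ε)) := by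
  have hinv : 1 ≤ ε⁻¹ := (one_le_inv₀ hε).mpr hε1
  calc ∑ j ∈ Finset.range k, μ ^ j / (j.factorial : ℝ)
      ≤ ∑ j ∈ Finset.range k, ε⁻¹ ^ k * ((ε * μ) ^ j / (j.factorial : ℝ)) := by
        refine Finset.sum_le_sum fun j hj => ?_
        have hjk : j ≤ k := (Finset.mem_range.mp hj).le
        have : μ ^ j = ε⁻¹ ^ j * (ε * μ) ^ j := by
          rw [← mul_pow, inv_mul_cancel_left₀ hε.ne']
        rw [this, mul_div_assoc]
        exact mul_le_mul_of_nonneg_right (pow_le_pow_right₀ hinv hjk) (by positivity)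
    _ = ε⁻¹ ^ k * ∑ j ∈ Finset.range k, (ε * μ) ^ j / (j.factorial : ℝ) := by
        rw [Finset.mul_sum]
    _ ≤ ε⁻¹ ^ k * Real.exp (ε * μ) :=
        mul_le_mul_of_nonneg_left (Real.sum_le_exp_of_nonneg (by positivity) k) (by positivity)
    _ = Real.exp (k * (-Real.log ε)) * Real.exp (ε * μ) := by
        rw [← Real.log_inv, mul_comm (k : ℝ), Real.exp_mul (Real.log _), Real.exp_log (by positivity),
          Real.rpow_natCast]
    _ ≤ Real.exp (μ * (Real.negMulLog ε + ε)) := by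
        rw [← Real.exp_add]
        apply Real.exp_le_exp.mpr
        unfold Real.negMulLog
        have : 0 ≤ -Real.log ε := by linarith [Real.log_nonpos hε.le hε1]
        nlinarith

lemma exists_eps {c : ℝ} (hc : 0 < c) : ∃ ε : ℝ, 0 < ε ∧ ε ≤ 1 ∧ Real.negMulLog ε + ε ≤ c := by
  have h1 : Filter.Tendsto (fun ε : ℝ => Real.negMulLog ε + ε) (𝓝 0) (𝓝 0) := by
    have : Continuous (fun ε : ℝ => Real.negMulLog ε + ε) :=
      Real.continuous_negMulLog.add continuous_id
    have h := this.tendsto 0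
    simpa using h
  have h2 := (h1.eventually (gt_mem_nhds hc))
  have h3 : ∀ᶠ ε : ℝ in 𝓝[>] 0, Real.negMulLog ε + ε < c := h2.filter_mono nhdsWithin_le_nhds
  have h4 : ∀ᶠ ε : ℝ in 𝓝[>] 0, 0 < ε := eventually_mem_nhdsWithin
  have h5 : ∀ᶠ ε : ℝ in 𝓝[>] 0, ε < 1 :=
    (gt_mem_nhds (by norm_num : (0 : ℝ) < 1)).filter_mono nhdsWithin_le_nhds
  obtain ⟨ε, ha, hb, hd⟩ := (h3.and (h4.and h5)).exists
  exact ⟨ε, hb, hd.le, ha.le⟩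

lemma num_big {N p θ c R : ℝ} {r l m y f : ℕ} (hN : 1 ≤ N) (hr : 1 ≤ r) (hl : r + 1 ≤ l)
    (hm : N ≤ 2 * r * (m : ℝ)) (hθ : θ * l = r) (hc0 : 0 ≤ c) (hc : c ≤ 1 / l)
    (hR : N ^ c ≤ R) (hp : R * N ^ (-θ) ≤ p) (hy : y ≤ r) (hf : 1 ≤ f) (hb : r * f ≤ l * y) :
    (2 * r : ℝ)⁻¹ ^ r * N ^ c * R ≤ (m : ℝ) ^ y * p ^ f := by
  have hN0 : (0 : ℝ) < N := by linarith
  have hrR : (1 : ℝ) ≤ r := by exact_mod_cast hr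
  have hlR : (0 : ℝ) < l := by exact_mod_cast (by omega : 0 < l)
  have hR0 : 0 < R := lt_of_lt_of_le (Real.rpow_pos_of_pos hN0 c) hR
  have h1 : (2 * r : ℝ)⁻¹ ^ r * N ^ y ≤ (m : ℝ) ^ y := by
    calc (2 * r : ℝ)⁻¹ ^ r * N ^ y ≤ (2 * r : ℝ)⁻¹ ^ y * N ^ y := by
          gcongr ?_ * _
          exact pow_le_pow_of_le_one (by positivity)
            (inv_le_one_of_one_le₀ (by linarith)) hy
      _ = ((2 * r : ℝ)⁻¹ * N) ^ y := (mul_pow _ _ _).symm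
      _ ≤ (m : ℝ) ^ y := by
          gcongr
          rw [inv_mul_le_iff₀ (by positivity)]
          exact hm
  obtain ⟨g, rfl⟩ : ∃ g, f = g + 1 := ⟨f - 1, by omega⟩
  have h2 : R * N ^ (c * g - θ * (g + 1)) ≤ p ^ (g + 1) := by
    calc R * N ^ (c * g - θ * (g + 1)) = R * ((N ^ c) ^ g * (N ^ (-θ)) ^ (g + 1)) := by
          rw [← Real.rpow_natCast (N ^ c), ← Real.rpow_mul hN0.le,
            ← Real.rpow_natCast (N ^ (-θ)), ← Real.rpow_mul hN0.le, ← Real.rpow_add hN0]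
          congr 2
          push_cast
          ring
      _ ≤ R * (R ^ g * (N ^ (-θ)) ^ (g + 1)) := by gcongr
      _ = (R * N ^ (-θ)) ^ (g + 1) := by rw [mul_pow, pow_succ R]; ring
      _ ≤ _ := by gcongr
  have h3 : N ^ c ≤ N ^ y * N ^ (c * g - θ * (g + 1)) := by
    rw [← Real.rpow_natCast N y, ← Real.rpow_add hN0]
    apply Real.rpow_le_rpow_of_exponent_le hN
    have hθ' : θ = r / l := by field_simp; linarith
    have hb' : (r : ℝ) * (g + 1) ≤ l * y := by exact_mod_cast hb
    rcases Nat.eq_zero_or_pos g with rfl | hg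
    · have hb2 : r + 1 ≤ l * y := by
        have : 1 ≤ y := by
          by_contra hy0
          have : y = 0 := by omega
          subst this
          omega
        nlinarith
      have hb3 : (r : ℝ) + 1 ≤ l * y := by exact_mod_cast hb2
      have : θ + 1 / l ≤ y := by
        rw [hθ', ← add_div, div_le_iff₀ hlR]; linarith
      push_cast
      linarith
    · have hg' : (1 : ℝ) ≤ g := by exact_mod_cast hg
      have : θ * (g + 1) ≤ y := by
        rw [hθ', div_mul_eq_mul_div, div_le_iff₀ hlR]; linarith
      nlinarith
  calc (2 * r : ℝ)⁻¹ ^ r * N ^ c * R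
      ≤ (2 * r : ℝ)⁻¹ ^ r * (N ^ y * N ^ (c * g - θ * (g + 1))) * R := by gcongr
    _ = ((2 * r : ℝ)⁻¹ ^ r * N ^ y) * (R * N ^ (c * g - θ * (g + 1))) := by ring
    _ ≤ _ := by gcongr

lemma sum_big {μ B : ℝ} {k : ℕ} (hμ : 0 ≤ μ) (hB : μ ≤ B) (hB1 : 1 ≤ B) :
    ∑ j ∈ Finset.range k, μ ^ j / (j.factorial : ℝ) ≤ Real.exp (1 + k * Real.log B) := by
  calc ∑ j ∈ Finset.range k, μ ^ j / (j.factorial : ℝ)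
      ≤ ∑ j ∈ Finset.range k, B ^ k * ((1 : ℝ) ^ j / (j.factorial : ℝ)) := by
        refine Finset.sum_le_sum fun j hj => ?_
        have hjk : j ≤ k := (Finset.mem_range.mp hj).le
        rw [one_pow, ← mul_div_assoc, mul_one]
        have : μ ^ j ≤ B ^ k :=
          (pow_le_pow_left₀ hμ hB j).trans (pow_le_pow_right₀ hB1 hjk)
        gcongr
    _ = B ^ k * ∑ j ∈ Finset.range k, (1 : ℝ) ^ j / (j.factorial : ℝ) := by
        rw [Finset.mul_sum]
    _ ≤ B ^ k * Real.exp 1 :=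
        mul_le_mul_of_nonneg_left (Real.sum_le_exp_of_nonneg (by positivity) k) (by positivity)
    _ = Real.exp (1 + k * Real.log B) := by
        rw [Real.exp_add, mul_comm (k : ℝ), Real.exp_mul, Real.exp_log (by linarith),
          Real.rpow_natCast, mul_comm]

end Numeric

section Assembly

variable [Fintype α]

lemma erProb_eq (n : ℕ) (p : ℝ) (A : Set (SimpleGraph (Fin n))) :
    erProb n p A = pr (⊤ : SimpleGraph (Fin n)).edgeFinset p
      (fun s => SimpleGraph.fromEdgeSet (↑s : Set (Sym2 (Fin n))) ∈ A) := by
  rfl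

lemma finish (H : SimpleGraph α) (p : ℕ → ℝ) (hp : ∀ n, p n ∈ Set.Icc (0 : ℝ) 1) (f : ℕ → ℝ)
    (h : ∀ᶠ n : ℕ in Filter.atTop, ∀ x y : Fin n, x ≠ y →
      pr (⊤ : SimpleGraph (Fin n)).edgeFinset (p n) (fun s => ¬ f n ≤
        (sigmaB H (SimpleGraph.fromEdgeSet (↑s : Set (Sym2 (Fin n)))) x y : ℝ)) ≤
        Real.exp (-(3 * Real.log n))) :
    Filter.Tendsto (fun n => erProb n (p n)
      {G | ∀ x y : Fin n, x ≠ y → f n ≤ (sigmaB H G x y : ℝ)}) Filter.atTop (nhds 1) := by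
  have hlow : ∀ᶠ n : ℕ in Filter.atTop, 1 - 1 / (n : ℝ) ≤ erProb n (p n)
      {G | ∀ x y : Fin n, x ≠ y → f n ≤ (sigmaB H G x y : ℝ)} := by
    filter_upwards [h, Filter.eventually_ge_atTop 1] with n hn hn1
    have hnR : (0 : ℝ) < n := by exact_mod_cast hn1
    rw [erProb_eq]
    set U := (⊤ : SimpleGraph (Fin n)).edgeFinset
    have h2 : pr U (p n) (fun s => ¬ ∀ x y : Fin n, x ≠ y → f n ≤
        (sigmaB H (SimpleGraph.fromEdgeSet (↑s : Set (Sym2 (Fin n)))) x y : ℝ)) ≤ 1 / n := by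
      have h3 := pr_exists_le U (hp n).1 (hp n).2
        ((Finset.univ : Finset (Fin n × Fin n)).filter fun q => q.1 ≠ q.2)
        (fun q s => ¬ f n ≤
          (sigmaB H (SimpleGraph.fromEdgeSet (↑s : Set (Sym2 (Fin n)))) q.1 q.2 : ℝ))
      have h4 : ∑ q ∈ (Finset.univ : Finset (Fin n × Fin n)).filter (fun q => q.1 ≠ q.2),
          pr U (p n) (fun s => ¬ f n ≤
          (sigmaB H (SimpleGraph.fromEdgeSet (↑s : Set (Sym2 (Fin n)))) q.1 q.2 : ℝ)) ≤ 1 / n := by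
        calc _ ≤ ∑ q ∈ (Finset.univ : Finset (Fin n × Fin n)).filter (fun q => q.1 ≠ q.2),
              Real.exp (-(3 * Real.log n)) :=
              Finset.sum_le_sum fun q hq => hn q.1 q.2 (Finset.mem_filter.mp hq).2
          _ = (((Finset.univ : Finset (Fin n × Fin n)).filter
              (fun q => q.1 ≠ q.2)).card : ℝ) * Real.exp (-(3 * Real.log n)) := by
              rw [Finset.sum_const, nsmul_eq_mul]
          _ ≤ ((n : ℝ) * n) * Real.exp (-(3 * Real.log n)) := by
              gcongr
              have : ((Finset.univ : Finset (Fin n × Fin n)).filter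
                (fun q => q.1 ≠ q.2)).card ≤ n * n := by
                refine (Finset.card_filter_le _ _).trans ?_
                simp
              exact_mod_cast this
          _ = 1 / n := by
              have : Real.exp (-(3 * Real.log n)) = ((n : ℝ) ^ 3)⁻¹ := by
                rw [Real.exp_neg, mul_comm, Real.exp_mul, Real.exp_log hnR]
                norm_cast
              rw [this]
              field_simp
      refine le_trans (pr_mono U (hp n).1 (hp n).2 ?_) (h3.trans h4)
      intro s _ hs
      push Not at hs
      obtain ⟨x, y, hxy, hlt⟩ := hs
      exact ⟨(x, y), by simpa using hxy, not_le.mpr hlt⟩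
    rw [pr_not] at h2
    simp only [Set.mem_ofPred_eq]
    linarith
  have hup : ∀ᶠ n : ℕ in Filter.atTop, erProb n (p n)
      {G | ∀ x y : Fin n, x ≠ y → f n ≤ (sigmaB H G x y : ℝ)} ≤ 1 := by
    refine Filter.Eventually.of_forall fun n => ?_
    rw [erProb_eq, ← pr_true (⊤ : SimpleGraph (Fin n)).edgeFinset (p n)]
    exact pr_mono _ (hp n).1 (hp n).2 fun _ _ _ => trivial
  have hlim : Filter.Tendsto (fun n : ℕ => 1 - 1 / (n : ℝ)) Filter.atTop (nhds 1) := by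
    simpa using (tendsto_one_div_atTop_nhds_zero_nat (𝕜 := ℝ)).const_sub 1
  exact tendsto_of_tendsto_of_tendsto_of_le_of_le' hlim tendsto_const_nhds hlow hup

end Assembly

section Final

variable [Fintype α]

lemma m_bounds {n r : ℕ} (hr : 1 ≤ r) (hn : 2 * r + 2 ≤ n) :
    r * ((n - 2) / r) + 2 ≤ n ∧ 0 < (n - 2) / r ∧ (n - 2) / r ≤ n ∧
      n ≤ 2 * (r * ((n - 2) / r)) := by
  have h1 := Nat.div_add_mod (n - 2) r
  have h2 := Nat.mod_lt (n - 2) (show r > 0 by omega)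
  refine ⟨by omega, Nat.div_pos (by omega) (by omega), ?_, by omega⟩
  exact (Nat.div_le_self _ _).trans (Nat.sub_le _ _)

lemma eIn_le (H : SimpleGraph α) (a b : α) (X : Finset α) : eIn H a b X ≤ (redE H a b).card :=
  Finset.card_filter_le _ _

lemma partI (H : SimpleGraph α) (hH : Strictly2Balanced H) {a b : α} (hab : H.Adj a b)
    {r l : ℕ} (hr : r = Fintype.card α - 2) (hl : l = eCount H - 1) (hrl : r + 1 ≤ l)
    {ε cr A θ δ : ℝ} (hcr : cr = 1 / 2 ^ (3 * r + 2)) (hA : A = rho H * (2 * r) ^ r)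
    (hε : 0 < ε) (hε1 : ε ≤ 1) (hεc : Real.negMulLog ε + ε ≤ cr / 2)
    (hθ : θ * l = r) (hδ0 : 0 ≤ δ) (hδ : δ * l ≤ 1 / l)
    (n : ℕ) (hn : 2 * r + 2 ≤ n) (hlog : 1 ≤ Real.log n) (hsq : 4 * r * (n : ℝ) ^ (1 / 2 : ℝ) ≤ n)
    {p : ℝ} (hp0 : 0 ≤ p) (hp1 : p ≤ 1) (hpu : p ≤ (n : ℝ) ^ (-θ + δ))
    (hΛ : A * (6 / cr + 2 / ε) * Real.log n < Lambda H n p) (x y : Fin n) (hxy : x ≠ y) :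
    pr (⊤ : SimpleGraph (Fin n)).edgeFinset p (fun s => ¬ ε / (2 * A) * Lambda H n p ≤
        (sigmaB H (SimpleGraph.fromEdgeSet (↑s : Set (Sym2 (Fin n)))) x y : ℝ)) ≤
      Real.exp (-(3 * Real.log n)) := by
  have h3 := card3 H hH
  have hr1 : 1 ≤ r := by omega
  have hrR : (1 : ℝ) ≤ r := by exact_mod_cast hr1
  have hlR : (2 : ℝ) ≤ l := by exact_mod_cast (by omega : 2 ≤ l)
  have hρ := rho_pos H hH
  have hA0 : 0 < A := by rw [hA]; positivity
  have hcr0 : 0 < cr := by rw [hcr]; positivity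
  obtain ⟨hm1, hm2, hm3, hm4⟩ := m_bounds hr1 hn
  set m := (n - 2) / r with hm
  have hnR : (1 : ℝ) ≤ n := by exact_mod_cast (by omega : 1 ≤ n)
  have hmR : (m : ℝ) ≤ n := by exact_mod_cast hm3
  have hmR0 : (0 : ℝ) < m := by exact_mod_cast hm2
  have hmn : (n : ℝ) ≤ 2 * r * m := by
    have : (n : ℝ) ≤ 2 * (r * m) := by exact_mod_cast hm4
    linarith
  have hl0 : l ≠ 0 := by omega
  have hΛ0 : 0 < Lambda H n p := lt_of_le_of_lt (by positivity) hΛ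
  have hpp : 0 < p := by
    rcases hp0.eq_or_lt with h | h
    · exfalso
      unfold Lambda at hΛ0
      rw [← h, ← hl, zero_pow hl0, mul_zero] at hΛ0
      exact lt_irrefl _ hΛ0
    · exact h
  set μ : ℝ := (m : ℝ) ^ r * p ^ l with hμ
  have hμ0 : 0 < μ := by positivity
  have hΛμ : Lambda H n p ≤ A * μ := by
    unfold Lambda
    rw [Nat.card_eq_fintype_card, ← hr, ← hl, hA, hμ]
    have h1 : ((n - 2).descFactorial r : ℝ) ≤ (2 * r * m) ^ r := by
      calc ((n - 2).descFactorial r : ℝ) ≤ ((n - 2 : ℕ) : ℝ) ^ r := by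
            exact_mod_cast Nat.descFactorial_le_pow _ _
        _ ≤ (n : ℝ) ^ r := by
            gcongr
            exact Nat.sub_le _ _
        _ ≤ _ := by gcongr
    calc rho H * ((n - 2).descFactorial r : ℝ) * p ^ l
        ≤ rho H * (2 * r * m) ^ r * p ^ l := by gcongr
      _ = _ := by rw [mul_pow]; ring
  have hμlog : (6 / cr + 2 / ε) * Real.log n < μ := by
    have : A * ((6 / cr + 2 / ε) * Real.log n) < A * μ := by linarith
    exact lt_of_mul_lt_mul_left this hA0.le
  have hμ1 : 6 / cr * Real.log n ≤ μ := by
    have : 0 ≤ 2 / ε * Real.log n := by positivity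
    linarith
  have hμ2 : 2 / ε ≤ μ := by
    have : 0 ≤ 6 / cr * Real.log n := by positivity
    have : 2 / ε ≤ 2 / ε * Real.log n := le_mul_of_one_le_right (by positivity) hlog
    linarith
  have hεμ : 2 ≤ ε * μ := by
    rw [div_le_iff₀ hε] at hμ2; linarith
  have hcμ : 3 * Real.log n ≤ cr / 2 * μ := by
    rw [div_mul_eq_mul_div, div_le_iff₀ hcr0] at hμ1; linarith
  set k := ⌈ε / (2 * A) * Lambda H n p⌉₊ with hk
  have hεΛ : ε / (2 * A) * Lambda H n p ≤ ε * μ / 2 := by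
    calc ε / (2 * A) * Lambda H n p ≤ ε / (2 * A) * (A * μ) := by gcongr
      _ = _ := by field_simp
  have hkε : (k : ℝ) ≤ ε * μ := by
    have := Nat.ceil_lt_add_one (show 0 ≤ ε / (2 * A) * Lambda H n p by positivity)
    rw [← hk] at this
    linarith
  have hδ2 : δ * l ≤ 1 / 2 := hδ.trans (one_div_le_one_div_of_le (by norm_num) hlR)
  have hμn : μ ≤ (n : ℝ) ^ (1 / 2 : ℝ) := num_mu hnR hmR hpp hθ hδ2 hpu
  have h2k : 2 * k ≤ m := by
    have h1 : (k : ℝ) ≤ (n : ℝ) ^ (1 / 2 : ℝ) := by nlinarith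
    have h2 : 4 * r * (n : ℝ) ^ (1 / 2 : ℝ) ≤ 2 * r * m := hsq.trans hmn
    have h3 : 2 * (n : ℝ) ^ (1 / 2 : ℝ) ≤ m := by
      have : (2 * r : ℝ) * (2 * (n : ℝ) ^ (1 / 2 : ℝ)) ≤ 2 * r * m := by linarith
      exact le_of_mul_le_mul_left this (by positivity)
    have : (2 * k : ℝ) ≤ m := by linarith
    exact_mod_cast this
  have hred : (redE H a b).card = l := by rw [redE_card H hab, hl]
  have hcore := sigma_core (H := H) hab (by omega) m n x y hxy (by rw [← hr]; exact hm1) hpp hp1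
    hμ0 k h2k hm2 (by omega) (by
      intro X haX hbX heX
      by_cases hX : X = Finset.univ
      · rw [hX, eIn_univ, hred, Finset.card_univ, ← hr]
      · obtain ⟨hX3, hXb⟩ := balance H hH hab X haX hbX hX heX
        rw [← hr, ← hl] at hXb
        have hfl : eIn H a b X ≤ l := by rw [← hred]; exact eIn_le H a b X
        have hyr : X.card - 2 ≤ r := by
          rw [hr]
          exact Nat.sub_le_sub_right (Finset.card_le_univ X) 2
        exact num_small hnR hmR hpp (by omega) hθ hδ hδ0 hpu hyr hfl hXb)
  rw [hred, ← hr, ← hμ] at hcore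
  refine le_trans (pr_mono _ hp0 hp1 ?_) (hcore.trans ?_)
  · intro s _ hs hks
    apply hs
    exact (Nat.le_ceil _).trans (by exact_mod_cast hks)
  · calc _ ≤ Real.exp (μ * (Real.negMulLog ε + ε)) * Real.exp (-(μ / 2 ^ (3 * r + 2))) :=
          mul_le_mul_of_nonneg_right (sum_small hμ0.le hε hε1 hkε) (Real.exp_pos _).le
      _ ≤ _ := by
          rw [← Real.exp_add]
          apply Real.exp_le_exp.mpr
          have h1 : μ / 2 ^ (3 * r + 2) = cr * μ := by rw [hcr]; ring
          have h2 : μ * (Real.negMulLog ε + ε) ≤ μ * (cr / 2) := by gcongr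
          rw [h1]
          linarith

lemma partII (H : SimpleGraph α) (hH : Strictly2Balanced H) {a b : α} (hab : H.Adj a b)
    {r l : ℕ} (hr : r = Fintype.card α - 2) (hl : l = eCount H - 1) (hrl : r + 1 ≤ l)
    {cr θ c ς pS : ℝ} (hcr : cr = 1 / 2 ^ (3 * r + 2))
    (hθ : θ * l = r) (hς : 0 < ς) (hcς : c = 2 * ς) (hc : c ≤ 1 / l)
    (n : ℕ) (hn : 2 * r + 2 ≤ n) (hlog : 1 ≤ Real.log n)
    (hk8 : 8 * r * (n : ℝ) ^ (ς + θ) ≤ n)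
    (hB : (4 + 2 * r) * Real.log n ≤ cr * (2 * r : ℝ)⁻¹ ^ r * (n : ℝ) ^ ς)
    (hpS : (n : ℝ) ^ (-θ) ≤ pS)
    {p : ℝ} (hp1 : p ≤ 1) (hpl : (n : ℝ) ^ c * pS ≤ p) (x y : Fin n) (hxy : x ≠ y) :
    pr (⊤ : SimpleGraph (Fin n)).edgeFinset p (fun s => ¬ (n : ℝ) ^ ς * (p / pS) ≤
        (sigmaB H (SimpleGraph.fromEdgeSet (↑s : Set (Sym2 (Fin n)))) x y : ℝ)) ≤
      Real.exp (-(3 * Real.log n)) := by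
  have h3 := card3 H hH
  have hr1 : 1 ≤ r := by omega
  have hrR : (1 : ℝ) ≤ r := by exact_mod_cast hr1
  have hcr0 : 0 < cr := by rw [hcr]; positivity
  obtain ⟨hm1, hm2, hm3, hm4⟩ := m_bounds hr1 hn
  set m := (n - 2) / r with hm
  have hnR : (1 : ℝ) ≤ n := by exact_mod_cast (by omega : 1 ≤ n)
  have hn0 : (0 : ℝ) < n := by linarith
  have hmR : (m : ℝ) ≤ n := by exact_mod_cast hm3
  have hmR0 : (0 : ℝ) < m := by exact_mod_cast hm2
  have hmn : (n : ℝ) ≤ 2 * r * m := by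
    have : (n : ℝ) ≤ 2 * (r * m) := by exact_mod_cast hm4
    linarith
  have hpS0 : 0 < pS := lt_of_lt_of_le (Real.rpow_pos_of_pos hn0 _) hpS
  have hpp : 0 < p := lt_of_lt_of_le (by positivity) hpl
  set R := p / pS with hR
  have hR0 : 0 < R := by positivity
  have hRc : (n : ℝ) ^ c ≤ R := by rw [hR, le_div_iff₀ hpS0]; exact hpl
  have hRp : R * (n : ℝ) ^ (-θ) ≤ p := by
    calc R * (n : ℝ) ^ (-θ) ≤ R * pS := by gcongr
      _ = p := by rw [hR]; field_simp
  have hRθ : R ≤ (n : ℝ) ^ θ := by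
    have h1 : R * (n : ℝ) ^ (-θ) ≤ 1 := hRp.trans hp1
    rw [Real.rpow_neg hn0.le, ← div_eq_mul_inv, div_le_one (Real.rpow_pos_of_pos hn0 _)] at h1
    exact h1
  have hR1 : 1 ≤ R := (Real.one_le_rpow hnR (by linarith)).trans hRc
  have hnς : 1 ≤ (n : ℝ) ^ ς := Real.one_le_rpow hnR hς.le
  have hnςR : 1 ≤ (n : ℝ) ^ ς * R := one_le_mul_of_one_le_of_one_le hnς hR1
  set k := ⌈(n : ℝ) ^ ς * R⌉₊ with hk
  have hk2 : (k : ℝ) ≤ 2 * ((n : ℝ) ^ ς * R) := by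
    have := Nat.ceil_lt_add_one (show 0 ≤ (n : ℝ) ^ ς * R by positivity)
    rw [← hk] at this
    linarith
  have h2k : 2 * k ≤ m := by
    have h1 : (n : ℝ) ^ ς * R ≤ (n : ℝ) ^ (ς + θ) := by
      rw [Real.rpow_add hn0]; gcongr
    have h3 : 4 * (n : ℝ) ^ (ς + θ) ≤ m := by
      have : (2 * r : ℝ) * (4 * (n : ℝ) ^ (ς + θ)) ≤ 2 * r * m := by linarith
      exact le_of_mul_le_mul_left this (by positivity)
    have : (2 * k : ℝ) ≤ m := by linarith
    exact_mod_cast this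
  have hred : (redE H a b).card = l := by rw [redE_card H hab, hl]
  set Φ : ℝ := (2 * r : ℝ)⁻¹ ^ r * (n : ℝ) ^ c * R with hΦ
  have hΦ0 : 0 < Φ := by positivity
  have hcore := sigma_core (H := H) hab (by omega) m n x y hxy (by rw [← hr]; exact hm1) hpp hp1
    hΦ0 k h2k hm2 (by omega) (by
      intro X haX hbX heX
      have hyr : X.card - 2 ≤ r := by
        rw [hr]
        exact Nat.sub_le_sub_right (Finset.card_le_univ X) 2
      refine num_big hnR hr1 hrl hmn hθ (by linarith) hc hRc hRp hyr heX ?_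
      by_cases hX : X = Finset.univ
      · rw [hX, eIn_univ, hred, Finset.card_univ, ← hr, mul_comm]
      · obtain ⟨hX3, hXb⟩ := balance H hH hab X haX hbX hX heX
        rw [← hr, ← hl] at hXb
        omega)
  rw [hred, ← hr] at hcore
  refine le_trans (pr_mono _ hpp.le hp1 ?_) (hcore.trans ?_)
  · intro s _ hs hks
    apply hs
    exact (Nat.le_ceil _).trans (by exact_mod_cast hks)
  · have hμB : (m : ℝ) ^ r * p ^ l ≤ (n : ℝ) ^ r := by
      calc (m : ℝ) ^ r * p ^ l ≤ (n : ℝ) ^ r * 1 := by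
            gcongr
            exact pow_le_one₀ hpp.le hp1
        _ = _ := mul_one _
    have hs := sum_big (k := k) (show 0 ≤ (m : ℝ) ^ r * p ^ l by positivity) hμB (one_le_pow₀ hnR)
    calc _ ≤ Real.exp (1 + k * Real.log ((n : ℝ) ^ r)) * Real.exp (-(Φ / 2 ^ (3 * r + 2))) :=
          mul_le_mul_of_nonneg_right hs (Real.exp_pos _).le
      _ ≤ _ := by
          rw [← Real.exp_add]
          apply Real.exp_le_exp.mpr
          rw [Real.log_pow]
          have h1 : Φ / 2 ^ (3 * r + 2) =
              cr * (2 * r : ℝ)⁻¹ ^ r * (n : ℝ) ^ ς * ((n : ℝ) ^ ς * R) := by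
            rw [hcr, hΦ, hcς, two_mul ς, Real.rpow_add hn0]; ring
          have h2 : (4 + 2 * r) * Real.log n * ((n : ℝ) ^ ς * R) ≤
              cr * (2 * r : ℝ)⁻¹ ^ r * (n : ℝ) ^ ς * ((n : ℝ) ^ ς * R) := by gcongr
          have h3 : (k : ℝ) * (r * Real.log n) ≤ 2 * ((n : ℝ) ^ ς * R) * (r * Real.log n) := by
            gcongr
          have h4 : 1 * Real.log n ≤ (n : ℝ) ^ ς * R * Real.log n := by gcongr
          rw [h1]
          linarith

lemma pStar_bounds (H : SimpleGraph α) (hH : Strictly2Balanced H)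
    {r l : ℕ} (hr : r = Fintype.card α - 2) (hl : l = eCount H - 1) (hrl : r + 1 ≤ l)
    {θ η : ℝ} (hθ : θ * l = r) (hη : 0 < η) :
    ∀ᶠ n : ℕ in Filter.atTop, (n : ℝ) ^ (-θ) ≤ pStar H n ∧ pStar H n ≤ (n : ℝ) ^ (-θ + η) := by
  have h3 := card3 H hH
  have h2 := two_le_eCount H hH
  have hlR : (0 : ℝ) < l := by exact_mod_cast (by omega : 0 < l)
  have hrR : (0 : ℝ) < r := by exact_mod_cast (by omega : 0 < r)
  have hrlR : (r : ℝ) + 1 ≤ l := by exact_mod_cast hrl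
  have hθ' : θ = r / l := by field_simp; linarith
  have hlc : (eCount H : ℝ) - 1 = l := by
    rw [hl, Nat.cast_sub (by omega)]; simp
  have hm2 : 1 / m2 H = θ := by
    rw [m2_eq H hH, d2_eq H hH, hlc, hθ', one_div_div, hr, Nat.cast_sub (by omega)]; simp
  have hρ := rho_pos H hH
  set K := (2 - θ) * (rho H)⁻¹ with hK
  have hθ1 : θ < 1 := by rw [hθ', div_lt_one hlR]; linarith
  have hK0 : 0 < K := by
    have : 0 < 2 - θ := by linarith
    positivity
  have hlog : Filter.Tendsto (fun n : ℕ => Real.log (n : ℝ)) Filter.atTop Filter.atTop :=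
    Real.tendsto_log_atTop.comp tendsto_natCast_atTop_atTop
  have e1 : ∀ᶠ n : ℕ in Filter.atTop, 1 / K ≤ Real.log (n : ℝ) := hlog.eventually_ge_atTop _
  have e2 : ∀ᶠ n : ℕ in Filter.atTop, ‖Real.log (n : ℝ)‖ ≤ 1 / K * ‖(n : ℝ) ^ (η * l)‖ :=
    tendsto_natCast_atTop_atTop.eventually
      ((isLittleO_log_rpow_atTop (mul_pos hη hlR)).bound (by positivity))
  filter_upwards [e1, e2, Filter.eventually_ge_atTop 1] with n h1 h2 hn
  have hnR : (1 : ℝ) ≤ n := by exact_mod_cast hn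
  have hn0 : (0 : ℝ) < n := by linarith
  have hps : pStar H n = (n : ℝ) ^ (-θ) * (K * Real.log n) ^ (1 / (l : ℝ)) := by
    unfold pStar
    rw [hm2, hlc]
  have hKl : 1 ≤ K * Real.log n := by
    rw [div_le_iff₀ hK0] at h1; linarith
  have hKu : K * Real.log n ≤ (n : ℝ) ^ (η * l) := by
    rw [Real.norm_of_nonneg (Real.log_nonneg hnR), Real.norm_of_nonneg (by positivity),
      div_mul_eq_mul_div, one_mul, le_div_iff₀ hK0] at h2
    linarith
  rw [hps]
  constructor
  · exact le_mul_of_one_le_right (by positivity) (Real.one_le_rpow hKl (by positivity))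
  · rw [Real.rpow_add hn0]
    gcongr
    calc (K * Real.log n) ^ (1 / (l : ℝ)) ≤ ((n : ℝ) ^ (η * l)) ^ (1 / (l : ℝ)) := by
          gcongr
      _ = (n : ℝ) ^ η := by
          rw [← Real.rpow_mul hn0.le]
          congr 1
          field_simp

lemma pStar_zero (H : SimpleGraph α) (hH : Strictly2Balanced H) (hd : d2 H = 1 / 2) (n : ℕ) :
    pStar H n = 0 := by
  have h2 := two_le_eCount H hH
  have h2' : (2 : ℝ) ≤ eCount H := by exact_mod_cast h2
  unfold pStar
  rw [m2_eq H hH, hd]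
  norm_num
  right
  apply Real.zero_rpow
  apply inv_ne_zero
  linarith

lemma ev_pow_le {s A : ℝ} (hs : s < 1) :
    ∀ᶠ n : ℕ in Filter.atTop, A * (n : ℝ) ^ s ≤ n := by
  have h1 : Filter.Tendsto (fun n : ℕ => (n : ℝ) ^ (1 - s)) Filter.atTop Filter.atTop :=
    (tendsto_rpow_atTop (by linarith)).comp tendsto_natCast_atTop_atTop
  filter_upwards [h1.eventually_ge_atTop A, Filter.eventually_ge_atTop 1] with n h2 hn
  have hn0 : (0 : ℝ) < n := by exact_mod_cast hn
  calc A * (n : ℝ) ^ s ≤ (n : ℝ) ^ (1 - s) * (n : ℝ) ^ s := by gcongr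
    _ = n := by rw [← Real.rpow_add hn0]; simp

lemma ev_log_le {s A B : ℝ} (hs : 0 < s) (hA : 0 < A) (hB : 0 < B) :
    ∀ᶠ n : ℕ in Filter.atTop, A * Real.log (n : ℝ) ≤ B * (n : ℝ) ^ s := by
  have e2 : ∀ᶠ n : ℕ in Filter.atTop, ‖Real.log (n : ℝ)‖ ≤ B / A * ‖(n : ℝ) ^ s‖ :=
    tendsto_natCast_atTop_atTop.eventually
      ((isLittleO_log_rpow_atTop hs).bound (by positivity))
  filter_upwards [e2, Filter.eventually_ge_atTop 1] with n h2 hn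
  have hnR : (1 : ℝ) ≤ n := by exact_mod_cast hn
  rw [Real.norm_of_nonneg (Real.log_nonneg hnR), Real.norm_of_nonneg (by positivity),
    div_mul_eq_mul_div, le_div_iff₀ hA] at h2
  linarith

end Final

/-- Corollary 4.10: lower bounds on `σ(x,y)` for all pairs, in the two
ranges of `p`. -/
theorem stmt17 {α : Type*} [Fintype α] (H : SimpleGraph α) (hH : Strictly2Balanced H)
    (hPT : NotPathOrTriangle H) :
    ∃ C c ς ε₀ : ℝ, 0 < C ∧ 0 < c ∧ 0 < ς ∧ 0 < ε₀ ∧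
      ∀ p : ℕ → ℝ, (∀ n, p n ∈ Set.Icc (0 : ℝ) 1) →
        ((∀ᶠ n : ℕ in Filter.atTop,
            C * Real.log n < Lambda H n (p n) ∧ p n < (n : ℝ) ^ (c : ℝ) * pStar H n) →
          Filter.Tendsto (fun n => erProb n (p n)
            {G | ∀ x y : Fin n, x ≠ y → ε₀ * Lambda H n (p n) ≤ (sigmaB H G x y : ℝ)})
            Filter.atTop (nhds 1)) ∧
        ((∀ᶠ n : ℕ in Filter.atTop, (n : ℝ) ^ (c : ℝ) * pStar H n ≤ p n) →
          Filter.Tendsto (fun n => erProb n (p n)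
            {G | ∀ x y : Fin n, x ≠ y →
              ε₀ * (n : ℝ) ^ (ς : ℝ) * (p n / pStar H n) ≤ (sigmaB H G x y : ℝ)})
            Filter.atTop (nhds 1)) := by
  by_cases hcase : ∃ u v w, H.Adj u v ∧ H.Adj u w ∧ v ≠ w
  · obtain ⟨u, v, w, huv, huw, hvw⟩ := hcase
    have hrl := caseA H hH hPT huv huw hvw
    obtain ⟨r, hr⟩ : ∃ r, r = Fintype.card α - 2 := ⟨_, rfl⟩
    obtain ⟨l, hl⟩ : ∃ l, l = eCount H - 1 := ⟨_, rfl⟩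
    rw [← hr, ← hl] at hrl
    have h3 := card3 H hH
    have hr1 : (1 : ℝ) ≤ r := by exact_mod_cast (by omega : 1 ≤ r)
    have hl2 : (2 : ℝ) ≤ l := by exact_mod_cast (by omega : 2 ≤ l)
    have hrlR : (r : ℝ) + 1 ≤ l := by exact_mod_cast hrl
    have hl0 : (0 : ℝ) < l := by linarith
    obtain ⟨θ, hθd⟩ : ∃ θ : ℝ, θ = r / l := ⟨_, rfl⟩
    have hθ : θ * l = r := by rw [hθd]; field_simp
    obtain ⟨c, hc⟩ : ∃ c : ℝ, c = 1 / (4 * (l : ℝ) ^ 2) := ⟨_, rfl⟩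
    have hc0 : 0 < c := by rw [hc]; positivity
    have hcl : c * l = 1 / 4 * (1 / l) := by rw [hc]; field_simp
    have hl1 : 1 / (l : ℝ) ≤ 1 := by
      rw [div_le_one hl0]; linarith
    have hlp : 0 < 1 / (l : ℝ) := by positivity
    have hcl2 : c ≤ 1 / 4 * (1 / l) := by
      rw [← hcl]
      exact le_mul_of_one_le_right hc0.le (by linarith)
    obtain ⟨cr, hcr⟩ : ∃ cr : ℝ, cr = 1 / 2 ^ (3 * r + 2) := ⟨_, rfl⟩
    have hcr0 : 0 < cr := by rw [hcr]; positivity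
    obtain ⟨A, hA⟩ : ∃ A : ℝ, A = rho H * (2 * r) ^ r := ⟨_, rfl⟩
    have hA0 : 0 < A := by
      have := rho_pos H hH
      rw [hA]; positivity
    obtain ⟨ε, hε, hε1, hεc⟩ := exists_eps (half_pos hcr0)
    have hlog : Filter.Tendsto (fun n : ℕ => Real.log (n : ℝ)) Filter.atTop Filter.atTop :=
      Real.tendsto_log_atTop.comp tendsto_natCast_atTop_atTop
    have hps := pStar_bounds H hH hr hl hrl hθ hc0
    refine ⟨A * (6 / cr + 2 / ε), c, c / 2, min 1 (ε / (2 * A)), by positivity, hc0,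
      by positivity, lt_min one_pos (by positivity), ?_⟩
    intro p hp
    constructor
    · intro hev
      apply finish H p hp (fun n => min 1 (ε / (2 * A)) * Lambda H n (p n))
      filter_upwards [hev, hps, hlog.eventually_ge_atTop 1,
        Filter.eventually_ge_atTop (2 * r + 2),
        ev_pow_le (s := 1 / 2) (A := 4 * r) (by norm_num)] with n hn hpsn hlogn hn2 hsq x y hxy
      have hn0 : (0 : ℝ) < n := by exact_mod_cast (by omega : 0 < n)
      have hpu : p n ≤ (n : ℝ) ^ (-θ + 2 * c) := by
        calc p n ≤ (n : ℝ) ^ c * pStar H n := hn.2.le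
          _ ≤ (n : ℝ) ^ c * (n : ℝ) ^ (-θ + c) := by gcongr; exact hpsn.2
          _ = _ := by rw [← Real.rpow_add hn0]; congr 1; ring
      have hmain := partI H hH huv hr hl hrl hcr hA hε hε1 hεc hθ
        (show 0 ≤ 2 * c by positivity) (by linarith) n hn2 hlogn hsq
        (hp n).1 (hp n).2 hpu hn.1 x y hxy
      refine le_trans (pr_mono _ (hp n).1 (hp n).2 ?_) hmain
      intro s _ hs hs2
      apply hs
      refine le_trans (mul_le_mul_of_nonneg_right (min_le_right _ _) ?_) hs2
      refine le_trans ?_ hn.1.le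
      positivity
    · intro hev
      apply finish H p hp
        (fun n => min 1 (ε / (2 * A)) * (n : ℝ) ^ (c / 2) * (p n / pStar H n))
      have hθ1 : θ ≤ 1 - 1 / l := by
        rw [hθd, le_sub_iff_add_le, ← add_div, div_le_one hl0]; exact hrlR
      filter_upwards [hev, hps, hlog.eventually_ge_atTop 1,
        Filter.eventually_ge_atTop (2 * r + 2),
        ev_pow_le (s := c / 2 + θ) (A := 8 * r) (by linarith),
        ev_log_le (s := c / 2) (A := 4 + 2 * r) (B := cr * (2 * r : ℝ)⁻¹ ^ r) (by positivity)
          (by positivity) (by positivity)] with n hn hpsn hlogn hn2 hk8 hB x y hxy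
      have hn0 : (0 : ℝ) < n := by exact_mod_cast (by omega : 0 < n)
      have hpS0 : 0 < pStar H n := lt_of_lt_of_le (Real.rpow_pos_of_pos hn0 _) hpsn.1
      have hmain := partII H hH huv hr hl hrl hcr hθ (show 0 < c / 2 by positivity)
        (show c = 2 * (c / 2) by ring) (by linarith) n hn2 hlogn hk8 hB hpsn.1 (hp n).2 hn x y hxy
      refine le_trans (pr_mono _ (hp n).1 (hp n).2 ?_) hmain
      intro s _ hs hs2
      apply hs
      refine le_trans ?_ hs2
      have h0 : 0 ≤ (n : ℝ) ^ (c / 2) * (p n / pStar H n) :=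
        mul_nonneg (by positivity) (div_nonneg (hp n).1 hpS0.le)
      rw [mul_assoc]
      exact mul_le_of_le_one_left h0 (min_le_left _ _)
  · have hd := caseB H hH hcase
    refine ⟨1, 1, 1, 1, one_pos, one_pos, one_pos, one_pos, ?_⟩
    intro p hp
    constructor
    · intro hev
      obtain ⟨n, hn⟩ := hev.exists
      rw [pStar_zero H hH hd, mul_zero] at hn
      exact absurd (hp n).1 (not_le.mpr hn.2)
    · intro _
      apply finish H p hp (fun n => 1 * (n : ℝ) ^ (1 : ℝ) * (p n / pStar H n))
      refine Filter.Eventually.of_forall fun n x y _ => ?_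
      have h0 : pr (⊤ : SimpleGraph (Fin n)).edgeFinset (p n) (fun s =>
          ¬ 1 * (n : ℝ) ^ (1 : ℝ) * (p n / pStar H n) ≤
        (sigmaB H (SimpleGraph.fromEdgeSet (↑s : Set (Sym2 (Fin n)))) x y : ℝ)) =
          1 - 1 := by
        rw [pr_not, ← pr_true (⊤ : SimpleGraph (Fin n)).edgeFinset (p n)]
        congr 2
        funext s
        rw [pStar_zero H hH hd]
        simp
      rw [h0, sub_self]
      exact (Real.exp_pos _).le

end RG
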